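/- Let Λ be an artin algebra and let X ⊂ Y be a Gabriel-Roiter inclusion of finite length Λ-modules. Then there exist an indecomposable finite length Λ-module M, an irreducible monomorphism f : X → M, and an epimorphism g : M → Y such that the composition g∘f : X → Y is a monomorphism (and hence g∘f is again a Gabriel-Roiter inclusion). -/

import Mathlib

/-!
Setting: `k` is a commutative artinian ring and `Λ` an artin `k`-algebra
(an algebra over `k` which is finitely generated as a `k`-module).
All modules considered are `Λ`-modules of finite length (`IsFiniteLength Λ M`),
and `|M|` denotes the length of `M`, implemented as the height
`Order.height (⊤ : Submodule Λ M)` of the lattice of submodules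
(for a submodule `N` of an ambient module, its length is `Order.height N`).
-/

universe u v

open Submodule

section GRDefs

variable (Λ : Type u) [Ring Λ]

/-- A submodule `N` of an ambient module is indecomposable (as a module):
it is nonzero, and whenever it is the direct sum of two submodules, one of them is zero. -/
def IndecSub {Y : Type v} [AddCommGroup Y] [Module Λ Y] (N : Submodule Λ Y) : Prop :=
  N ≠ ⊥ ∧ ∀ A B : Submodule Λ Y, A ≤ N → B ≤ N → A ⊔ B = N → A ⊓ B = ⊥ → A = ⊥ ∨ B = ⊥

/-- A module is indecomposable iff its top submodule is. -/
def IndecMod (M : Type v) [AddCommGroup M] [Module Λ M] : Prop :=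
  IndecSub Λ (⊤ : Submodule Λ M)

/-- The length `|M|` of a module, as an extended natural number. -/
noncomputable def modLen (M : Type v) [AddCommGroup M] [Module Λ M] : ℕ∞ :=
  Order.height (⊤ : Submodule Λ M)

/-- The length `|N|` of a submodule of an ambient module, as a natural number. -/
noncomputable def subLen {Y : Type v} [AddCommGroup Y] [Module Λ Y] (N : Submodule Λ Y) : ℕ :=
  (Order.height N).toNat

open Classical in
/-- Fuel-based auxiliary function for the Gabriel-Roiter measure. -/
noncomputable def muAux {Y : Type v} [AddCommGroup Y] [Module Λ Y] :
    ℕ → Submodule Λ Y → ℝ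
  | 0, _ => 0
  | n + 1, N =>
      (if IndecSub Λ N then (2 : ℝ) ^ (-(subLen Λ N : ℤ)) else 0)
        + sSup (muAux n '' {N' : Submodule Λ Y | N' < N})

/-- The Gabriel-Roiter measure `μ(N)` of a submodule `N` of an ambient module:
`μ(0) = 0`; if `N ≠ 0` is decomposable, `μ(N)` is the maximum of `μ(N')` over proper
submodules `N'` of `N`; if `N` is indecomposable, `μ(N) = 2^(-|N|)` plus this maximum.
(For modules of finite length the supremum is a maximum and the fuel `|N|` suffices for
the recursion, so this agrees with the usual inductive definition; the measure of a
submodule depends only on the sublattice of its submodules, hence it does not matter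
in which ambient module it is computed.) -/
noncomputable def mu {Y : Type v} [AddCommGroup Y] [Module Λ Y] (N : Submodule Λ Y) : ℝ :=
  muAux Λ (subLen Λ N) N

/-- The Gabriel-Roiter measure of a module. -/
noncomputable def muMod (M : Type v) [AddCommGroup M] [Module Λ M] : ℝ :=
  mu Λ (⊤ : Submodule Λ M)

/-- `X` is a Gabriel-Roiter submodule of the (indecomposable, non-simple) ambient
module `Y`: `X` is an indecomposable proper submodule with `μ(Y) = μ(X) + 2^(-|Y|)`. -/
def IsGRSub {Y : Type v} [AddCommGroup Y] [Module Λ Y] (X : Submodule Λ Y) : Prop :=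
  IndecMod Λ Y ∧ IndecSub Λ X ∧ X ≠ ⊤ ∧
    mu Λ (⊤ : Submodule Λ Y) = mu Λ X + (2 : ℝ) ^ (-(subLen Λ (⊤ : Submodule Λ Y) : ℤ))

/-- A map `u : X → Y` is a Gabriel-Roiter inclusion iff it is injective and its
image is a Gabriel-Roiter submodule of `Y`. -/
def IsGRInclusion {X Y : Type v} [AddCommGroup X] [Module Λ X] [AddCommGroup Y] [Module Λ Y]
    (u : X →ₗ[Λ] Y) : Prop :=
  Function.Injective u ∧ IsGRSub Λ (LinearMap.range u)

/-- A linear map is a split monomorphism. -/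
def IsSplitMonoHom {A B : Type v} [AddCommGroup A] [Module Λ A] [AddCommGroup B] [Module Λ B]
    (f : A →ₗ[Λ] B) : Prop :=
  ∃ g : B →ₗ[Λ] A, g.comp f = LinearMap.id

/-- A linear map is a split epimorphism. -/
def IsSplitEpiHom {A B : Type v} [AddCommGroup A] [Module Λ A] [AddCommGroup B] [Module Λ B]
    (f : A →ₗ[Λ] B) : Prop :=
  ∃ g : B →ₗ[Λ] A, f.comp g = LinearMap.id

/-- A morphism `f` in the category of finite length `Λ`-modules is irreducible if it is
neither a split monomorphism nor a split epimorphism and, whenever `f = g ∘ h` with the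
intermediate module of finite length, either `h` is a split monomorphism or `g` is a
split epimorphism. -/
def IsIrreducibleHom {A B : Type v} [AddCommGroup A] [Module Λ A] [AddCommGroup B] [Module Λ B]
    (f : A →ₗ[Λ] B) : Prop :=
  ¬ IsSplitMonoHom Λ f ∧ ¬ IsSplitEpiHom Λ f ∧
    ∀ (Z : Type v) [AddCommGroup Z] [Module Λ Z], IsFiniteLength Λ Z →
      ∀ (h : A →ₗ[Λ] Z) (g : Z →ₗ[Λ] B), f = g.comp h →
        IsSplitMonoHom Λ h ∨ IsSplitEpiHom Λ g

/-- An indecomposable submodule `U` of the ambient module is piling provided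
`μ(V) ≤ μ(U)` for every indecomposable submodule `V` with `|V| ≤ |U|`. -/
def IsPilingSub {Y : Type v} [AddCommGroup Y] [Module Λ Y] (U : Submodule Λ Y) : Prop :=
  IndecSub Λ U ∧ ∀ V : Submodule Λ Y, IndecSub Λ V →
    Order.height V ≤ Order.height U → mu Λ V ≤ mu Λ U

/-- A Gabriel-Roiter filtration `c 0 ⊂ c 1 ⊂ ⋯ ⊂ c t = N` of an (indecomposable)
submodule `N`: a chain of indecomposable submodules starting at a simple module such
that each inclusion `c i ⊂ c (i+1)` is a Gabriel-Roiter inclusion,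
i.e. `μ(c (i+1)) = μ(c i) + 2^(-|c (i+1)|)`. -/
def IsGRFiltration {Y : Type v} [AddCommGroup Y] [Module Λ Y] {t : ℕ}
    (c : Fin (t + 1) → Submodule Λ Y) (N : Submodule Λ Y) : Prop :=
  c (Fin.last t) = N ∧
  IsSimpleModule Λ (c 0) ∧
  (∀ i : Fin (t + 1), IndecSub Λ (c i)) ∧
  ∀ i : Fin t, c i.castSucc < c i.succ ∧
    mu Λ (c i.succ) = mu Λ (c i.castSucc) + (2 : ℝ) ^ (-(subLen Λ (c i.succ) : ℤ))

/-- A brick: a nonzero module all of whose nonzero endomorphisms are invertible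
(i.e. the endomorphism ring is a division ring). -/
def IsBrick (M : Type v) [AddCommGroup M] [Module Λ M] : Prop :=
  (∃ x : M, x ≠ 0) ∧ ∀ f : M →ₗ[Λ] M, f ≠ 0 → Function.Bijective f

/-- An `M`-filtration `0 = c 0 ⊂ c 1 ⊂ ⋯ ⊂ c m = Y` of the module `Y`
(so `c j` is the module `M[j]`, with `M[0] = 0`, and the `M`-length of `Y` is `m`):
all consecutive factors `c (i+1) / c i` are isomorphic to `M`. -/
structure IsMFiltration (M : Type v) [AddCommGroup M] [Module Λ M]
    {Y : Type v} [AddCommGroup Y] [Module Λ Y] {m : ℕ}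
    (c : Fin (m + 1) → Submodule Λ Y) : Prop where
  bot : c 0 = ⊥
  top : c (Fin.last m) = ⊤
  lt : ∀ i : Fin m, c i.castSucc < c i.succ
  quot : ∀ i : Fin m,
    Nonempty ((↥(c i.succ) ⧸ comap (c i.succ).subtype (c i.castSucc)) ≃ₗ[Λ] M)

/-- A homogeneous `M`-filtration: an `M`-filtration in which moreover all the
`M[i] = c i` with `i ≥ 1` are indecomposable and all the inclusions
`M[i-1] ⊂ M[i]` for `2 ≤ i ≤ m` are irreducible monomorphisms. -/
structure IsHomogMFiltration (M : Type v) [AddCommGroup M] [Module Λ M]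
    {Y : Type v} [AddCommGroup Y] [Module Λ Y] {m : ℕ}
    (c : Fin (m + 1) → Submodule Λ Y) extends IsMFiltration Λ M c : Prop where
  indec : ∀ i : Fin (m + 1), i ≠ 0 → IndecSub Λ (c i)
  irr : ∀ i : Fin m, (i : ℕ) ≠ 0 →
    IsIrreducibleHom Λ (Submodule.inclusion (toIsMFiltration.lt i).le)

end GRDefs

universe w

section GRMeasure

variable {Λ : Type u} [Ring Λ]

lemma subLen_eq_length {Y : Type*} [AddCommGroup Y] [Module Λ Y] (N : Submodule Λ Y) :
    subLen Λ N = (Module.length Λ N).toNat := by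
  rw [subLen, Module.length_submodule]

lemma exists_le_map_eq {A B : Type*} [AddCommGroup A] [Module Λ A] [AddCommGroup B] [Module Λ B]
    (φ : A →ₗ[Λ] B) {N : Submodule Λ A} {C : Submodule Λ B} (h : C ≤ N.map φ) :
    ∃ C' ≤ N, C'.map φ = C := by
  refine ⟨N ⊓ C.comap φ, inf_le_left, le_antisymm ?_ fun x hx => ?_⟩
  · rintro _ ⟨x, ⟨-, hx⟩, rfl⟩
    exact hx
  · obtain ⟨a, ha, rfl⟩ := h hx
    exact ⟨a, ⟨ha, hx⟩, rfl⟩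

section Map

variable {A : Type*} {B : Type*} [AddCommGroup A] [Module Λ A] [AddCommGroup B] [Module Λ B]
  {φ : A →ₗ[Λ] B} (hφ : Function.Injective φ)

include hφ

lemma subLen_map (N : Submodule Λ A) : subLen Λ (N.map φ) = subLen Λ N := by
  rw [subLen_eq_length, subLen_eq_length, (Submodule.equivMapOfInjective φ hφ N).length_eq]

lemma map_eq_bot_iff_of_inj (N : Submodule Λ A) : N.map φ = ⊥ ↔ N = ⊥ := by
  rw [← Submodule.map_bot φ]
  exact (Submodule.map_injective_of_injective hφ).eq_iff

lemma indecSub_map (N : Submodule Λ A) : IndecSub Λ (N.map φ) ↔ IndecSub Λ N := by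
  have hinj := Submodule.map_injective_of_injective hφ
  constructor
  · rintro ⟨h0, h⟩
    refine ⟨fun h' => h0 (by rw [h', Submodule.map_bot]), fun C D hC hD hs hi => ?_⟩
    have := h (C.map φ) (D.map φ) (Submodule.map_mono hC) (Submodule.map_mono hD)
      (by rw [← Submodule.map_sup, hs]) (by rw [← Submodule.map_inf φ hφ, hi, Submodule.map_bot])
    simpa only [map_eq_bot_iff_of_inj hφ] using this
  · rintro ⟨h0, h⟩
    refine ⟨by rwa [Ne, map_eq_bot_iff_of_inj hφ], fun C D hC hD hs hi => ?_⟩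
    obtain ⟨C, hC', rfl⟩ := exists_le_map_eq φ hC
    obtain ⟨D, hD', rfl⟩ := exists_le_map_eq φ hD
    rw [← Submodule.map_sup] at hs
    rw [← Submodule.map_inf φ hφ, map_eq_bot_iff_of_inj hφ] at hi
    simpa only [map_eq_bot_iff_of_inj hφ] using h C D hC' hD' (hinj hs) hi

lemma muAux_map (n : ℕ) : ∀ N : Submodule Λ A, muAux Λ n (N.map φ) = muAux Λ n N := by
  induction n with
  | zero => intro N; rfl
  | succ n ih =>
    intro N
    have hset : muAux Λ n '' {N' : Submodule Λ B | N' < N.map φ} =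
        muAux Λ n '' {N' : Submodule Λ A | N' < N} := by
      ext r
      constructor
      · rintro ⟨C, hC, rfl⟩
        obtain ⟨C, hC', rfl⟩ := exists_le_map_eq φ (le_of_lt hC)
        exact ⟨C, lt_of_le_of_ne hC' (by rintro rfl; exact lt_irrefl (C.map φ) hC), (ih C).symm⟩
      · rintro ⟨C, hC, rfl⟩
        exact ⟨C.map φ, Submodule.map_strictMono_of_injective hφ hC, ih C⟩
    rw [muAux, muAux, hset, subLen_map hφ]
    congr 1
    classical exact if_congr (indecSub_map hφ N) rfl rfl

lemma mu_map (N : Submodule Λ A) : mu Λ (N.map φ) = mu Λ N := by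
  rw [mu, mu, muAux_map hφ, subLen_map hφ]

lemma mu_range : mu Λ (LinearMap.range φ) = mu Λ (⊤ : Submodule Λ A) := by
  rw [← mu_map hφ, Submodule.map_top]

lemma indecSub_range : IndecSub Λ (LinearMap.range φ) ↔ IndecMod Λ A := by
  rw [IndecMod, ← indecSub_map hφ, Submodule.map_top]

end Map

variable {Y : Type*} [AddCommGroup Y] [Module Λ Y]

lemma indecMod_coe (N : Submodule Λ Y) : IndecMod Λ N ↔ IndecSub Λ N := by
  rw [← indecSub_range N.injective_subtype, Submodule.range_subtype]

lemma mu_coe (N : Submodule Λ Y) : mu Λ (⊤ : Submodule Λ N) = mu Λ N := by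
  rw [← mu_range N.injective_subtype, Submodule.range_subtype]

lemma muAux_bot (n : ℕ) : muAux Λ n (⊥ : Submodule Λ Y) = 0 := by
  cases n with
  | zero => rfl
  | succ n =>
    have h : ¬ IndecSub Λ (⊥ : Submodule Λ Y) := fun h => h.1 rfl
    simp [muAux, h, not_lt_bot]

variable [IsNoetherian Λ Y] [IsArtinian Λ Y]

lemma subLen_lt {N N' : Submodule Λ Y} (h : N' < N) : subLen Λ N' < subLen Λ N := by
  have := Submodule.height_strictMono h
  rw [← ENat.natCast_toNat (N'.height_lt_top).ne, ← ENat.natCast_toNat (N.height_lt_top).ne] at this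
  exact_mod_cast this

lemma subLen_mono {N N' : Submodule Λ Y} (h : N' ≤ N) : subLen Λ N' ≤ subLen Λ N := by
  rcases h.eq_or_lt with rfl | h
  exacts [le_rfl, (subLen_lt h).le]

/-- `r` is a dyadic number with denominator `2 ^ l` that lies in `[0, 1 - 2 ^ (-l)]`. -/
def IsDyadic (l : ℕ) (r : ℝ) : Prop :=
  ∃ j : ℕ, j + 1 ≤ 2 ^ l ∧ r = j / 2 ^ l

lemma IsDyadic.mono {l m : ℕ} {r : ℝ} (hlm : l ≤ m) (h : IsDyadic l r) : IsDyadic m r := by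
  obtain ⟨d, rfl⟩ := Nat.exists_eq_add_of_le hlm
  obtain ⟨j, hj, rfl⟩ := h
  refine ⟨j * 2 ^ d, ?_, ?_⟩
  · have : 0 < 2 ^ d := by positivity
    rw [pow_add]
    nlinarith
  · rw [pow_add]
    push_cast
    field_simp

lemma IsDyadic.succ {l : ℕ} {r : ℝ} (h : IsDyadic l r) :
    IsDyadic (l + 1) (2 ^ (-((l + 1 : ℕ) : ℤ)) + r) := by
  obtain ⟨j, hj, rfl⟩ := h
  refine ⟨2 * j + 1, by rw [pow_succ]; omega, ?_⟩
  rw [zpow_neg, zpow_natCast, pow_succ]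
  push_cast
  field_simp
  ring

lemma IsDyadic.nonneg {l : ℕ} {r : ℝ} (h : IsDyadic l r) : 0 ≤ r := by
  obtain ⟨j, -, rfl⟩ := h
  positivity

lemma isDyadic_finite (l : ℕ) : {r : ℝ | IsDyadic l r}.Finite := by
  refine ((Finset.range (2 ^ l)).finite_toSet.image fun j : ℕ => (j : ℝ) / 2 ^ l).subset ?_
  rintro r ⟨j, hj, rfl⟩
  exact ⟨j, by simpa using hj, rfl⟩

lemma IsDyadic.add_lt {l : ℕ} {r s : ℝ} (hr : IsDyadic l r) (hs : IsDyadic l s) (h : r < s) :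
    r + 2 ^ (-((l + 1 : ℕ) : ℤ)) < s := by
  obtain ⟨i, -, rfl⟩ := hr
  obtain ⟨j, -, rfl⟩ := hs
  have h2 : (0 : ℝ) < 2 ^ l := by positivity
  rw [div_lt_div_iff_of_pos_right h2] at h
  have hij : (i : ℝ) + 1 ≤ j := by exact_mod_cast h
  rw [zpow_neg, zpow_natCast, pow_succ, lt_div_iff₀ h2]
  field_simp
  linarith

lemma sSup_muAux_mem {n : ℕ} {N : Submodule Λ Y} (hN : N ≠ ⊥)
    (h : ∀ N' < N, IsDyadic (subLen Λ N') (muAux Λ n N')) :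
    sSup (muAux Λ n '' {N' : Submodule Λ Y | N' < N}) ∈
      muAux Λ n '' {N' : Submodule Λ Y | N' < N} := by
  refine Set.Nonempty.csSup_mem ⟨_, ⊥, bot_lt_iff_ne_bot.2 hN, rfl⟩
    ((isDyadic_finite (subLen Λ N)).subset ?_)
  rintro _ ⟨N', hN', rfl⟩
  exact (h N' hN').mono (subLen_lt hN').le

lemma isDyadic_muAux (n : ℕ) : ∀ N : Submodule Λ Y, subLen Λ N ≤ n →
    IsDyadic (subLen Λ N) (muAux Λ n N) := by
  induction n with
  | zero =>
    intro N hN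
    exact ⟨0, Nat.one_le_two_pow, by simp [muAux]⟩
  | succ n ih =>
    intro N hN
    by_cases h0 : N = ⊥
    · subst h0
      exact ⟨0, Nat.one_le_two_pow, by simp [muAux_bot]⟩
    have hlt : ∀ N' < N, IsDyadic (subLen Λ N') (muAux Λ n N') := fun N' hN' =>
      ih N' (by have := subLen_lt hN'; omega)
    obtain ⟨N', hN', h⟩ := sSup_muAux_mem h0 hlt
    obtain ⟨l, hl⟩ : ∃ l, subLen Λ N = l + 1 :=
      ⟨subLen Λ N - 1, by have := subLen_lt (show N' < N from hN'); omega⟩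
    have hd : IsDyadic l (muAux Λ n N') :=
      (hlt N' hN').mono (by have := subLen_lt (show N' < N from hN'); omega)
    rw [muAux, ← h, hl]
    split_ifs
    · exact hd.succ
    · rw [zero_add]
      exact hd.mono l.le_succ

lemma muAux_eq_muAux (n : ℕ) : ∀ (m : ℕ) (N : Submodule Λ Y), subLen Λ N ≤ n → subLen Λ N ≤ m →
    muAux Λ n N = muAux Λ m N := by
  induction n with
  | zero =>
    intro m N hn hm
    have h0 : N = ⊥ := by
      by_contra h
      have := subLen_lt (bot_lt_iff_ne_bot.2 h)
      omega
    rw [h0, muAux_bot, muAux_bot]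
  | succ n ih =>
    intro m N hn hm
    cases m with
    | zero =>
      have h0 : N = ⊥ := by
        by_contra h
        have := subLen_lt (bot_lt_iff_ne_bot.2 h)
        omega
      rw [h0, muAux_bot, muAux_bot]
    | succ m =>
      rw [muAux, muAux]
      congr 2
      refine Set.image_congr fun N' hN' => ?_
      have hlt := subLen_lt (show N' < N from hN')
      exact ih m N' (by omega) (by omega)

lemma isDyadic_mu (N : Submodule Λ Y) : IsDyadic (subLen Λ N) (mu Λ N) :=
  isDyadic_muAux _ N le_rfl

open Classical in
/-- The recursion defining the Gabriel-Roiter measure, with the supremum attained. -/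
lemma exists_isMax_mu {N : Submodule Λ Y} (hN : N ≠ ⊥) :
    ∃ N' < N, (∀ V < N, mu Λ V ≤ mu Λ N') ∧
      mu Λ N = (if IndecSub Λ N then (2 : ℝ) ^ (-(subLen Λ N : ℤ)) else 0) + mu Λ N' := by
  have hpos := subLen_lt (bot_lt_iff_ne_bot.2 hN)
  obtain ⟨l, hl⟩ : ∃ l, subLen Λ N = l + 1 := ⟨subLen Λ N - 1, by omega⟩
  have hlt : ∀ V < N, muAux Λ l V = mu Λ V := fun V hV =>
    muAux_eq_muAux _ _ _ (by have := subLen_lt hV; omega) le_rfl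
  have hdy : ∀ V < N, IsDyadic (subLen Λ V) (muAux Λ l V) := fun V hV => by
    rw [hlt V hV]
    exact isDyadic_mu V
  obtain ⟨N', hN', h⟩ := sSup_muAux_mem hN hdy
  refine ⟨N', hN', fun V hV => ?_, ?_⟩
  · rw [← hlt V hV, ← hlt N' hN', h]
    refine le_csSup (((isDyadic_finite (subLen Λ N)).subset ?_).bddAbove) ⟨V, hV, rfl⟩
    rintro _ ⟨W, hW, rfl⟩
    exact (hdy W hW).mono (subLen_lt hW).le
  · rw [← hlt N' hN', h, mu, hl, muAux, hl]

lemma mu_mono {N N' : Submodule Λ Y} (h : N' ≤ N) : mu Λ N' ≤ mu Λ N := by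
  rcases h.eq_or_lt with rfl | h
  · rfl
  obtain ⟨V, -, hV, hmu⟩ := exists_isMax_mu (bot_lt_iff_ne_bot.1 (bot_le.trans_lt h))
  have := hV N' h
  rw [hmu]
  split_ifs
  · have : (0 : ℝ) < 2 ^ (-(subLen Λ N : ℤ)) := by positivity
    linarith
  · linarith

lemma mu_add_le {N N' : Submodule Λ Y} (hN : IndecSub Λ N) (h : N' < N) :
    mu Λ N' + 2 ^ (-(subLen Λ N : ℤ)) ≤ mu Λ N := by
  obtain ⟨V, -, hV, hmu⟩ := exists_isMax_mu hN.1
  have := hV N' h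
  rw [hmu, if_pos hN]
  linarith

lemma mu_lt {N N' : Submodule Λ Y} (hN : IndecSub Λ N) (h : N' < N) : mu Λ N' < mu Λ N := by
  have := mu_add_le hN h
  have : (0 : ℝ) < 2 ^ (-(subLen Λ N : ℤ)) := by positivity
  linarith

lemma mu_nonneg (N : Submodule Λ Y) : 0 ≤ mu Λ N := (isDyadic_mu N).nonneg

/-- The measure of a nonzero submodule is attained on an indecomposable submodule. -/
lemma exists_indecSub_mu_eq (N : Submodule Λ Y) (hN : N ≠ ⊥) :
    ∃ V ≤ N, IndecSub Λ V ∧ mu Λ V = mu Λ N := by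
  induction N using (wellFounded_lt (α := Submodule Λ Y)).induction with
  | h N ih =>
    by_cases hind : IndecSub Λ N
    · exact ⟨N, le_rfl, hind, rfl⟩
    obtain ⟨W, hWN, hW, hmu⟩ := exists_isMax_mu hN
    rw [if_neg hind, zero_add] at hmu
    have hpos : 0 < mu Λ N := by
      simp only [IndecSub, not_and, not_forall, not_or] at hind
      obtain ⟨A, B, hA, -, hs, hi, hA0, hB0⟩ := hind hN
      have hlt : A < N := by
        refine lt_of_le_of_ne hA ?_
        rintro rfl
        exact hB0 (by rwa [inf_eq_right.2 (le_sup_right.trans hs.le)] at hi)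
      obtain ⟨V, hVA, hV, -⟩ := ih A hlt hA0
      exact (mu_nonneg ⊥).trans_lt ((mu_lt hV (bot_lt_iff_ne_bot.2 hV.1)).trans_le
        (mu_mono (hVA.trans hA)))
    have hW0 : W ≠ ⊥ := by
      rintro rfl
      rw [hmu, mu, muAux_bot] at hpos
      exact lt_irrefl _ hpos
    obtain ⟨V, hVW, hV, hVmu⟩ := ih W hWN hW0
    exact ⟨V, hVW.trans hWN.le, hV, hVmu.trans hmu.symm⟩

/-- An indecomposable submodule that is not simple has a Gabriel-Roiter submodule. -/
lemma exists_gabrielRoiter_sub {N V : Submodule Λ Y} (hN : IndecSub Λ N) (hV : V ≠ ⊥)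
    (hVN : V < N) :
    ∃ W < N, IndecSub Λ W ∧ mu Λ N = mu Λ W + 2 ^ (-(subLen Λ N : ℤ)) := by
  obtain ⟨W, hWN, hW, hmu⟩ := exists_isMax_mu hN.1
  rw [if_pos hN] at hmu
  have hW0 : W ≠ ⊥ := by
    rintro rfl
    obtain ⟨U, hUV, hU, -⟩ := exists_indecSub_mu_eq V hV
    exact absurd (mu_lt hU (bot_lt_iff_ne_bot.2 hU.1))
      (not_lt.2 ((mu_mono hUV).trans (hW V hVN)))
  obtain ⟨U, hUW, hU, hUmu⟩ := exists_indecSub_mu_eq W hW0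
  exact ⟨U, hUW.trans_lt hWN, hU, by rw [hmu, hUmu, add_comm]⟩

/-- Measures of modules shorter than an indecomposable module with Gabriel-Roiter submodule `W`
that exceed `μ(W)` also exceed the measure of the module itself. -/
lemma mu_lt_of_subLen_lt {N W V : Submodule Λ Y} (hWN : W < N)
    (hN : mu Λ N = mu Λ W + 2 ^ (-(subLen Λ N : ℤ)))
    (hV : subLen Λ V < subLen Λ N) (h : mu Λ W < mu Λ V) : mu Λ N < mu Λ V := by
  have hW := subLen_lt hWN
  obtain ⟨l, hl⟩ : ∃ l, subLen Λ N = l + 1 := ⟨subLen Λ N - 1, by omega⟩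
  rw [hN, hl]
  exact ((isDyadic_mu W).mono (by omega)).add_lt ((isDyadic_mu V).mono (by omega)) h

end GRMeasure

section Decomposition

variable {Λ : Type u} [Ring Λ]

/-- Every idempotent endomorphism of a finite length module is a finite sum of idempotent
endomorphisms with indecomposable images. -/
lemma exists_list_idempotent {E : Type*} [AddCommGroup E] [Module Λ E] [IsArtinian Λ E]
    (N : Submodule Λ E) : ∀ e : Module.End Λ E, e * e = e → LinearMap.range e = N →
    ∃ l : List (Module.End Λ E), l.sum = e ∧
      ∀ a ∈ l, a * a = a ∧ IndecSub Λ (LinearMap.range a) := by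
  induction N using (wellFounded_lt (α := Submodule Λ E)).induction with
  | h N ih =>
    intro e he hN
    by_cases h0 : N = ⊥
    · exact ⟨[], (LinearMap.range_eq_bot.1 (hN.trans h0)).symm, by simp⟩
    by_cases hind : IndecSub Λ N
    · exact ⟨[e], by simp, by simpa [he, hN] using hind⟩
    simp only [IndecSub, not_and, not_forall, not_or] at hind
    obtain ⟨A, B, hA, hB, hs, hi, hA0, hB0⟩ := hind h0
    have he' : ∀ x, e (e x) = e x := fun x => LinearMap.congr_fun he x
    have hfix : ∀ x ∈ N, e x = x := by
      intro x hx
      rw [← hN] at hx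
      obtain ⟨y, rfl⟩ := hx
      exact he' y
    have hc : IsCompl A (B ⊔ LinearMap.ker e) := by
      constructor
      · rw [Submodule.disjoint_def]
        intro x hxA hx
        obtain ⟨b, hb, c, hc, rfl⟩ := Submodule.mem_sup.1 hx
        have h1 := hfix _ (hA hxA)
        rw [map_add, LinearMap.mem_ker.1 hc, hfix b (hB hb), add_zero] at h1
        rw [← h1] at hxA ⊢
        exact (Submodule.mem_bot Λ).1 (hi ▸ ⟨hxA, hb⟩)
      · rw [codisjoint_iff, ← sup_assoc, hs, eq_top_iff]
        intro x _
        refine Submodule.mem_sup.2 ⟨e x, hN ▸ ⟨x, rfl⟩, x - e x, ?_, by abel⟩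
        rw [LinearMap.mem_ker, map_sub, he', sub_self]
    set p : Module.End Λ E := A.projection _ hc with hp
    have hpA : ∀ x ∈ A, p x = x := fun x hx => projection_apply_of_mem_left hc hx
    have hpm : ∀ x, p x ∈ A := projection_apply_mem hc
    have hpp : p * p = p := LinearMap.ext fun x => hpA _ (hpm x)
    have hep : e * p = p := LinearMap.ext fun x => hfix _ (hA (hpm x))
    have hpe : p * e = p := by
      ext x
      rw [Module.End.mul_apply, ← sub_eq_zero, ← map_sub]
      refine projection_apply_of_mem_right hc (Submodule.mem_sup_right ?_)
      rw [LinearMap.mem_ker, map_sub, he', sub_self]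
    have hqq : (e - p) * (e - p) = e - p := by
      rw [sub_mul, mul_sub, mul_sub, he, hep, hpe, hpp]
      abel
    have hrp : LinearMap.range p = A := range_projection hc
    have hAN : A < N := by
      refine lt_of_le_of_ne hA ?_
      rintro rfl
      exact hB0 (by rwa [inf_eq_right.2 hB] at hi)
    have hqN : LinearMap.range (e - p) < N := by
      refine lt_of_le_of_ne ?_ fun h => hA0 ?_
      · rintro _ ⟨x, rfl⟩
        exact N.sub_mem (hN ▸ ⟨x, rfl⟩) (hA (hpm x))
      · rw [eq_bot_iff]
        intro x hx
        obtain ⟨y, hy⟩ : x ∈ LinearMap.range (e - p) := h ▸ hA hx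
        have h1 : p x = 0 := by
          rw [← hy, ← Module.End.mul_apply, mul_sub, hpe, hpp, sub_self, LinearMap.zero_apply]
        rw [Submodule.mem_bot, ← hpA x hx, h1]
    obtain ⟨l₁, hl₁, h₁⟩ := ih A hAN p hpp hrp
    obtain ⟨l₂, hl₂, h₂⟩ := ih _ hqN (e - p) hqq rfl
    refine ⟨l₁ ++ l₂, by rw [List.sum_append, hl₁, hl₂, add_sub_cancel], fun a ha => ?_⟩
    exact (List.mem_append.1 ha).elim (h₁ a) (h₂ a)

variable {Y : Type*} [AddCommGroup Y] [Module Λ Y]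

/-- A finite length module is jointly embedded by maps onto indecomposable submodules. -/
lemma exists_jointly_injective [IsArtinian Λ Y] (N : Submodule Λ Y) :
    ∃ P : Set (N →ₗ[Λ] Y), (∀ x, (∀ p ∈ P, p x = 0) → x = 0) ∧
      ∀ p ∈ P, LinearMap.range p ≤ N ∧ IndecSub Λ (LinearMap.range p) := by
  obtain ⟨l, hl, h⟩ := exists_list_idempotent (⊤ : Submodule Λ N) 1 (one_mul 1)
    (LinearMap.range_eq_top.2 Function.surjective_id)
  refine ⟨{p | ∃ a ∈ l, p = N.subtype ∘ₗ a}, fun x hx => ?_, ?_⟩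
  · have hx' : ∀ a ∈ l, a x = 0 := fun a ha =>
      N.injective_subtype (by rw [map_zero]; exact hx _ ⟨a, ha, rfl⟩)
    have h1 : (l.sum : Module.End Λ N) x = 0 := by
      clear hl h hx
      induction l with
      | nil => rfl
      | cons a l ih =>
        simp only [List.mem_cons, forall_eq_or_imp] at hx'
        rw [List.sum_cons, LinearMap.add_apply, hx'.1, ih hx'.2, add_zero]
    rwa [hl] at h1
  · rintro _ ⟨a, ha, rfl⟩
    rw [LinearMap.range_comp]
    exact ⟨Submodule.map_subtype_le _ _, (indecSub_map N.injective_subtype _).2 (h a ha).2⟩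

lemma IndecSub.not_retract {X W : Submodule Λ Y} (hX : IndecSub Λ X) (hWX : W < X) (hW : W ≠ ⊥)
    (r : X →ₗ[Λ] W) : ¬ ∀ w : W, r (Submodule.inclusion hWX.le w) = w := by
  intro hr
  have hK : (LinearMap.ker r).map X.subtype ≤ X := Submodule.map_subtype_le _ _
  have hsup : W ⊔ (LinearMap.ker r).map X.subtype = X := by
    refine le_antisymm (sup_le hWX.le hK) fun x hx => ?_
    refine Submodule.mem_sup.2 ⟨r ⟨x, hx⟩, (r ⟨x, hx⟩).2, x - r ⟨x, hx⟩,
      ⟨⟨x, hx⟩ - Submodule.inclusion hWX.le (r ⟨x, hx⟩), ?_, rfl⟩, by abel⟩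
    rw [SetLike.mem_coe, LinearMap.mem_ker, map_sub, hr, sub_self]
  have hinf : W ⊓ (LinearMap.ker r).map X.subtype = ⊥ := by
    rw [eq_bot_iff]
    rintro _ ⟨hxW, y, hy, rfl⟩
    have h1 : y = Submodule.inclusion hWX.le ⟨y, hxW⟩ := rfl
    have h2 := hr ⟨y, hxW⟩
    rw [← h1, LinearMap.mem_ker.1 hy] at h2
    exact (congrArg Subtype.val h2).symm
  rcases hX.2 W _ hWX.le hK hsup hinf with h | h
  · exact hW h
  · rw [map_eq_bot_iff_of_inj X.injective_subtype, LinearMap.ker_eq_bot] at h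
    obtain ⟨x, hx, hxW⟩ := SetLike.exists_of_lt hWX
    have := h (hr (r ⟨x, hx⟩))
    have h' : ((r ⟨x, hx⟩ : W) : Y) = x := congrArg Subtype.val this
    exact hxW (h' ▸ (r ⟨x, hx⟩).2)

variable [IsNoetherian Λ Y] [IsArtinian Λ Y]

lemma subLen_range_le {X : Submodule Λ Y} (v : X →ₗ[Λ] Y) :
    subLen Λ (LinearMap.range v) ≤ subLen Λ X := by
  rw [subLen_eq_length, subLen_eq_length]
  exact ENat.toNat_le_toNat (Module.length_le_of_surjective _ v.surjective_rangeRestrict)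
    Module.length_ne_top

lemma subLen_range_lt {X : Submodule Λ Y} (v : X →ₗ[Λ] Y) (hv : ¬ Function.Injective v) :
    subLen Λ (LinearMap.range v) < subLen Λ X := by
  rw [← LinearMap.ker_eq_bot] at hv
  rw [subLen_eq_length, subLen_eq_length,
    ← (LinearMap.quotKerEquivRange v).length_eq]
  have := Submodule.length_quotient_lt (LinearMap.ker v) hv
  rw [← ENat.natCast_toNat (Module.length_ne_top (R := Λ) (M := X)),
    ← ENat.natCast_toNat (Module.length_ne_top (R := Λ) (M := X ⧸ LinearMap.ker v))] at this
  exact_mod_cast this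

/-- Gabriel's main property of the Gabriel-Roiter measure. -/
lemma exists_injective_or_mu_lt (X : Submodule Λ Y) : IndecSub Λ X → ∀ S : Set (X →ₗ[Λ] Y),
    (∀ x, (∀ v ∈ S, v x = 0) → x = 0) →
    ∃ v ∈ S, Function.Injective v ∨ mu Λ X < mu Λ (LinearMap.range v) := by
  induction X using (wellFounded_lt (α := Submodule Λ Y)).induction with
  | h X ih =>
    intro hX S hS
    by_contra! hcon
    obtain ⟨V, hV, hVX⟩ : ∃ V : Submodule Λ Y, V ≠ ⊥ ∧ V < X := by
      obtain ⟨x, hx, hx0⟩ := X.ne_bot_iff.1 hX.1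
      obtain ⟨v, hv, hvx⟩ : ∃ v ∈ S, v ⟨x, hx⟩ ≠ 0 := by
        by_contra! h
        exact hx0 (congrArg Subtype.val (hS ⟨x, hx⟩ h))
      refine ⟨(LinearMap.ker v).map X.subtype, ?_,
        lt_of_le_of_ne (Submodule.map_subtype_le _ _) fun h => hvx ?_⟩
      · rw [Ne, map_eq_bot_iff_of_inj X.injective_subtype, LinearMap.ker_eq_bot]
        exact (hcon v hv).1
      · obtain ⟨y, hy, hyx⟩ : x ∈ (LinearMap.ker v).map X.subtype := h.ge hx
        rwa [show y = ⟨x, hx⟩ from Subtype.ext hyx] at hy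
    obtain ⟨W, hWX, hW, hmu⟩ := exists_gabrielRoiter_sub hX hV hVX
    choose P hP0 hP using fun N : Submodule Λ Y => exists_jointly_injective N
    obtain ⟨w, ⟨v, hv, p, hp, rfl⟩, hw⟩ := ih W hWX hW
      {w | ∃ v ∈ S, ∃ p ∈ P (LinearMap.range v),
        w = (p ∘ₗ v.rangeRestrict) ∘ₗ Submodule.inclusion hWX.le} fun x hx => by
          refine Submodule.inclusion_injective hWX.le ?_
          rw [map_zero]
          exact hS _ fun v hv => congrArg Subtype.val
            (hP0 _ (v.rangeRestrict _) fun p hp => hx _ ⟨v, hv, p, hp, rfl⟩)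
    obtain ⟨hpv, hpi⟩ := hP _ p hp
    set w := (p ∘ₗ v.rangeRestrict) ∘ₗ Submodule.inclusion hWX.le with hwdef
    have hwp : LinearMap.range w ≤ LinearMap.range p := by
      rintro _ ⟨x, rfl⟩
      exact ⟨_, rfl⟩
    have hlt : mu Λ W < mu Λ (LinearMap.range p) := by
      rcases hw with hw | hw
      · rcases hwp.eq_or_lt with heq | hlt
        · exfalso
          have hr : ∀ x, (p ∘ₗ v.rangeRestrict) x ∈ LinearMap.range w :=
            fun x => heq ▸ ⟨_, rfl⟩
          refine hX.not_retract hWX hW.1 ((LinearEquiv.ofInjective w hw).symm.toLinearMap ∘ₗ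
            (p ∘ₗ v.rangeRestrict).codRestrict _ hr) fun x => ?_
          exact (LinearEquiv.symm_apply_eq _).2 rfl
        · calc mu Λ W = mu Λ (LinearMap.range w) := by rw [mu_range hw, mu_coe]
            _ < _ := mu_lt hpi hlt
      · exact hw.trans_le (mu_mono hwp)
    have hlen : subLen Λ (LinearMap.range p) < subLen Λ X :=
      (subLen_mono hpv).trans_lt (subLen_range_lt v (hcon v hv).1)
    exact absurd (mu_lt_of_subLen_lt hWX hmu hlen hlt)
      (not_lt.2 ((mu_mono hpv).trans (hcon v hv).2))

end Decomposition

section Duality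

variable {k : Type u} [CommRing k]

lemma exists_baer_embedding (F : Type u) [AddCommGroup F] [Module k F] :
    ∃ (I : Type u) (_ : AddCommGroup I) (_ : Module k I) (i : F →ₗ[k] I),
      Module.Baer k I ∧ Function.Injective i := by
  let I := CategoryTheory.Injective.under (ModuleCat.of k F)
  have : CategoryTheory.Injective (ModuleCat.of k I) :=
    CategoryTheory.Injective.injective_under (ModuleCat.of k F)
  have hI : Module.Injective k I := Module.injective_module_of_injective_object k I
  exact ⟨I, inferInstance, inferInstance,
    (CategoryTheory.Injective.ι (ModuleCat.of k F)).hom, Module.Baer.of_injective hI,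
    (ModuleCat.mono_iff_injective _).1 inferInstance⟩

lemma Module.Baer.of_retract {I E : Type*} [AddCommGroup I] [Module k I] [AddCommGroup E]
    [Module k E] (hI : Module.Baer k I) (i : E →ₗ[k] I) (r : I →ₗ[k] E) (h : ∀ x, r (i x) = x) :
    Module.Baer k E := fun J g => by
  obtain ⟨g', hg'⟩ := hI J (i ∘ₗ g)
  exact ⟨r ∘ₗ g', fun x hx => by rw [LinearMap.comp_apply, hg' x hx, LinearMap.comp_apply, h]⟩

/-- Existence of injective hulls. -/
lemma exists_injective_hull (F : Type u) [AddCommGroup F] [Module k F] :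
    ∃ (E : Type u) (_ : AddCommGroup E) (_ : Module k E) (i : F →ₗ[k] E),
      Module.Baer k E ∧ Function.Injective i ∧
        ∀ x : E, x ≠ 0 → ∃ r : k, r • x ≠ 0 ∧ r • x ∈ LinearMap.range i := by
  obtain ⟨I, _, _, i, hI, hi⟩ := exists_baer_embedding (k := k) F
  obtain ⟨E, hFE, hE⟩ := zorn_le_nonempty₀ {E : Submodule k I | LinearMap.range i ≤ E ∧
      ∀ x ∈ E, x ≠ 0 → ∃ r : k, r • x ≠ 0 ∧ r • x ∈ LinearMap.range i}
    (fun c hc hchain E hEc => ⟨sSup c, ⟨(hc hEc).1.trans (le_sSup hEc), fun x hx hx0 => by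
      obtain ⟨D, hD, hxD⟩ := (Submodule.mem_sSup_of_directed ⟨E, hEc⟩ hchain.directedOn).1 hx
      exact (hc hD).2 x hxD hx0⟩, fun D hD => le_sSup hD⟩)
    (LinearMap.range i) ⟨le_rfl, fun x hx hx0 => ⟨1, by simpa, by simpa⟩⟩
  obtain ⟨C, -, hC⟩ := zorn_le_nonempty₀ {C : Submodule k I | ∀ x ∈ C, x ∈ E → x = 0}
    (fun c hc hchain D hDc => ⟨sSup c, fun x hx hxE => by
      obtain ⟨D, hD, hxD⟩ := (Submodule.mem_sSup_of_directed ⟨D, hDc⟩ hchain.directedOn).1 hx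
      exact hc hD x hxD hxE, fun D hD => le_sSup hD⟩)
    ⊥ (fun x hx _ => (Submodule.mem_bot k).1 hx)
  have hinj : Function.Injective (C.mkQ ∘ₗ E.subtype) := by
    rw [injective_iff_map_eq_zero]
    intro x hx
    exact Subtype.ext (hC.1 x ((Submodule.Quotient.mk_eq_zero C).1 hx) x.2)
  obtain ⟨g, hg⟩ := hI.extension_property _ hinj E.subtype
  have hgE : ∀ x ∈ E, g (C.mkQ x) = x := fun x hx => LinearMap.congr_fun hg ⟨x, hx⟩
  have hkey : ∀ y, y ∉ C → ∃ r : k, r • g (C.mkQ y) ≠ 0 ∧ r • g (C.mkQ y) ∈ E := by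
    intro y hy
    by_contra! hcon
    refine hy (hC.le_of_ge (y := C ⊔ span k {y}) ?_ le_sup_left
      (mem_sup_right (mem_span_singleton_self y)))
    intro x hx hxE
    obtain ⟨c, hc, z, hz, rfl⟩ := mem_sup.1 hx
    obtain ⟨r, rfl⟩ := mem_span_singleton.1 hz
    have h1 : r • g (C.mkQ y) = c + r • y := by
      have := hgE _ hxE
      rwa [map_add, map_add, map_smul, map_smul, C.mkQ_apply c,
        (Submodule.Quotient.mk_eq_zero C).2 hc, map_zero, zero_add] at this
    by_contra h0
    exact hcon r (by rwa [h1]) (by rwa [h1])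
  have hgr : ∀ y, g (C.mkQ y) ∈ E := by
    intro y
    refine hE.le_of_ge (y := LinearMap.range g) ⟨fun x hx => ?_, ?_⟩ (fun x hx => ?_) ⟨_, rfl⟩
    · exact ⟨C.mkQ x, hgE x (hFE hx)⟩
    · rintro _ ⟨y, rfl⟩ hy0
      obtain ⟨y, rfl⟩ := C.mkQ_surjective y
      obtain ⟨r, hr0, hrE⟩ := hkey y fun hy => hy0 (by
        rw [C.mkQ_apply, (Submodule.Quotient.mk_eq_zero C).2 hy, map_zero])
      obtain ⟨s, hs0, hs⟩ := hE.1.2 _ hrE hr0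
      exact ⟨s * r, by rwa [mul_smul], by rwa [mul_smul]⟩
    · exact ⟨C.mkQ x, hgE x hx⟩
  refine ⟨E, inferInstance, inferInstance, i.codRestrict E fun x => hFE ⟨x, rfl⟩,
    hI.of_retract E.subtype ((g ∘ₗ C.mkQ).codRestrict E hgr) fun x => Subtype.ext (hgE x x.2),
    fun x y hxy => hi (congrArg Subtype.val hxy), fun x hx0 => ?_⟩
  obtain ⟨r, hr0, y, hy⟩ := hE.1.2 x x.2 fun h => hx0 (Subtype.ext h)
  exact ⟨r, fun h => hr0 (congrArg Subtype.val h), y, Subtype.ext hy⟩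

/-- A module `E` over a commutative ring suitable for dualizing finite length modules: it is
an injective cogenerator, and the duals of finite length modules do not have bigger length. -/
structure IsDualizing (E : Type u) [AddCommGroup E] [Module k E] : Prop where
  baer : Module.Baer k E
  exists_ne_zero : ∀ m : Ideal k, m.IsMaximal → ∃ e : E, e ≠ 0 ∧ ∀ r ∈ m, r • e = 0
  exists_smul : ∀ m : Ideal k, m.IsMaximal → ∃ e : E, (∀ r ∈ m, r • e = 0) ∧
    ∀ x : E, (∀ r ∈ m, r • x = 0) → ∃ r : k, x = r • e

variable (k) in
lemma exists_isDualizing : ∃ (E : Type u) (_ : AddCommGroup E) (_ : Module k E),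
    IsDualizing (k := k) E := by
  classical
  obtain ⟨E, _, _, i, hE, hi, hess⟩ :=
    exists_injective_hull (k := k) (∀ m : MaximalSpectrum k, k ⧸ m.asIdeal)
  have hann : ∀ m : MaximalSpectrum k, ∀ r ∈ m.asIdeal, r • i (Pi.single m 1) = 0 := by
    intro m r hr
    have h0 : r • (1 : k ⧸ m.asIdeal) = 0 := by
      rw [Algebra.smul_def, mul_one, Ideal.Quotient.algebraMap_eq,
        Ideal.Quotient.eq_zero_iff_mem.2 hr]
    rw [← map_smul, ← map_zero i]
    congr 1
    ext n
    by_cases hn : n = m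
    · subst hn
      rw [Pi.smul_apply, Pi.single_eq_same, h0, Pi.zero_apply]
    · rw [Pi.smul_apply, Pi.single_eq_of_ne hn, smul_zero, Pi.zero_apply]
  refine ⟨E, inferInstance, inferInstance, hE, fun m hm => ?_, fun m hm => ?_⟩
  · refine ⟨i (Pi.single ⟨m, hm⟩ 1), ?_, hann ⟨m, hm⟩⟩
    rw [Ne, map_eq_zero_iff i hi, Pi.single_eq_zero_iff]
    exact one_ne_zero
  · refine ⟨i (Pi.single ⟨m, hm⟩ 1), hann ⟨m, hm⟩, fun x hx => ?_⟩
    by_cases hx0 : x = 0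
    · exact ⟨0, by rw [hx0, zero_smul]⟩
    obtain ⟨r, hr0, hr⟩ := hess x hx0
    have hrm : r ∉ m := fun h => hr0 (hx r h)
    obtain ⟨s, hs⟩ := hm.exists_inv hrm
    obtain ⟨t, ht, hst⟩ := hs
    have hxr : x = s • r • x := by
      conv_lhs => rw [← one_smul k x, ← hst, add_smul, hx t ht, add_zero, mul_smul]
    obtain ⟨a, ha⟩ : x ∈ LinearMap.range i := hxr ▸ Submodule.smul_mem _ s hr
    have ham : ∀ r ∈ m, r • a = 0 := fun r hr => hi (by rw [map_smul, ha, hx r hr, map_zero])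
    obtain ⟨c, hc⟩ := Ideal.Quotient.mk_surjective (a ⟨m, hm⟩)
    refine ⟨c, ?_⟩
    rw [← ha, ← map_smul]
    congr 1
    ext n
    by_cases hn : n = ⟨m, hm⟩
    · subst hn
      rw [Pi.smul_apply, Pi.single_eq_same, ← hc, Algebra.smul_def, mul_one]
      rfl
    · rw [Pi.smul_apply, Pi.single_eq_of_ne hn, smul_zero]
      obtain ⟨b, hb⟩ := Ideal.Quotient.mk_surjective (a n)
      obtain ⟨t, htm, htn⟩ : ∃ t ∈ m, t ∉ n.asIdeal := by
        by_contra! h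
        exact hn (MaximalSpectrum.ext (hm.eq_of_le n.isMaximal.ne_top h).symm)
      have h1 := congrFun (ham t htm) n
      rw [Pi.smul_apply, ← hb, Algebra.smul_def, Ideal.Quotient.algebraMap_eq, ← map_mul,
        Pi.zero_apply, Ideal.Quotient.eq_zero_iff_mem] at h1
      rw [← hb, Ideal.Quotient.eq_zero_iff_mem]
      exact (n.isMaximal.isPrime.mem_or_mem h1).resolve_left htn

variable {E : Type u} [AddCommGroup E] [Module k E] (hE : IsDualizing (k := k) E)

include hE

lemma IsDualizing.exists_separating {V : Type*} [AddCommGroup V] [Module k V] (U : Submodule k V)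
    (x : V) (hx : x ∉ U) : ∃ ψ : V →ₗ[k] E, (∀ y ∈ U, ψ y = 0) ∧ ψ x ≠ 0 := by
  set τ : k →ₗ[k] V ⧸ U := LinearMap.toSpanSingleton k _ (U.mkQ x) with hτ
  have hne : LinearMap.ker τ ≠ ⊤ := fun h => hx (by
    have : τ 1 = 0 := LinearMap.mem_ker.1 (h ▸ trivial)
    rwa [hτ, LinearMap.toSpanSingleton_apply, one_smul, U.mkQ_apply,
      Submodule.Quotient.mk_eq_zero] at this)
  obtain ⟨m, hm, hle⟩ := Ideal.exists_le_maximal _ hne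
  obtain ⟨e, he0, he⟩ := hE.exists_ne_zero m hm
  obtain ⟨h, hh⟩ := hE.baer.extension_property ((LinearMap.ker τ).liftQ τ le_rfl)
    (LinearMap.ker_eq_bot.1 (Submodule.ker_liftQ_eq_bot _ _ _ le_rfl))
    ((LinearMap.ker τ).liftQ (LinearMap.toSpanSingleton k E e)
      fun r hr => LinearMap.mem_ker.2 (he r (hle hr)))
  refine ⟨h ∘ₗ U.mkQ, fun y hy => ?_, ?_⟩
  · rw [LinearMap.comp_apply, U.mkQ_apply, (Submodule.Quotient.mk_eq_zero U).2 hy, map_zero]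
  · have := LinearMap.congr_fun hh ((LinearMap.ker τ).mkQ 1)
    simp only [LinearMap.comp_apply, mkQ_apply, liftQ_apply, hτ,
      LinearMap.toSpanSingleton_apply, one_smul] at this
    rw [LinearMap.comp_apply, U.mkQ_apply, this]
    exact he0

lemma IsDualizing.length_dual_simple_le (S : Type*) [AddCommGroup S] [Module k S]
    [IsSimpleModule k S] : Module.length k (S →ₗ[k] E) ≤ 1 := by
  obtain ⟨m, hm, ⟨e⟩⟩ := isSimpleModule_iff_quot_maximal.1 (inferInstance : IsSimpleModule k S)
  obtain ⟨x, hx, hxm⟩ := hE.exists_smul m hm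
  have hx' : m ≤ LinearMap.ker (LinearMap.toSpanSingleton k E x) :=
    fun r hr => LinearMap.mem_ker.2 (hx r hr)
  set φ : S →ₗ[k] E := m.liftQ (LinearMap.toSpanSingleton k E x) hx' ∘ₗ e.toLinearMap with hφ
  have hφm : m ≤ LinearMap.ker (LinearMap.toSpanSingleton k (S →ₗ[k] E) φ) := by
    intro r hr
    rw [LinearMap.mem_ker, LinearMap.toSpanSingleton_apply]
    ext s
    obtain ⟨t, ht⟩ := m.mkQ_surjective (e s)
    rw [LinearMap.smul_apply, hφ, LinearMap.comp_apply, LinearEquiv.coe_coe, ← ht, mkQ_apply,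
      liftQ_apply, LinearMap.toSpanSingleton_apply, smul_comm, hx r hr, smul_zero,
      LinearMap.zero_apply]
  have hsurj : Function.Surjective (m.liftQ (LinearMap.toSpanSingleton k (S →ₗ[k] E) φ) hφm) := by
    intro ψ
    obtain ⟨r, hr⟩ := hxm (ψ (e.symm (m.mkQ 1))) fun t ht => by
      rw [← map_smul, ← map_smul, ← map_smul, smul_eq_mul, mul_one, mkQ_apply,
        (Submodule.Quotient.mk_eq_zero m).2 ht, map_zero, map_zero]
    refine ⟨m.mkQ r, ?_⟩
    ext s
    obtain ⟨t, ht⟩ := m.mkQ_surjective (e s)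
    have hs : s = t • e.symm (m.mkQ 1) := by
      rw [← map_smul, ← map_smul, smul_eq_mul, mul_one, ht, e.symm_apply_apply]
    rw [mkQ_apply, liftQ_apply, LinearMap.toSpanSingleton_apply, LinearMap.smul_apply, hφ,
      LinearMap.comp_apply, LinearEquiv.coe_coe, ← ht, mkQ_apply,
      liftQ_apply, LinearMap.toSpanSingleton_apply, hs, map_smul, hr, smul_comm]
  have : IsSimpleModule k (k ⧸ m) := isSimpleModule_iff_quot_maximal.2 ⟨m, hm, ⟨.refl k _⟩⟩
  exact (Module.length_le_of_surjective _ hsurj).trans (Module.length_eq_one k _).le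

lemma IsDualizing.length_dual_le {V : Type w} [AddCommGroup V] [Module k V]
    (hV : IsFiniteLength k V) : Module.length k (V →ₗ[k] E) ≤ Module.length k V := by
  induction hV with
  | of_subsingleton =>
    rw [Module.length_eq_zero]
    exact zero_le
  | @of_simple_quotient V _ _ N _ hN ih =>
    set res := LinearMap.lcomp k E N.subtype with hres
    have h1 : Module.length k (V →ₗ[k] E) =
        Module.length k (LinearMap.ker res) + Module.length k (LinearMap.range res) :=
      Module.length_eq_add_of_exact (LinearMap.ker res).subtype res.rangeRestrict
        (Submodule.injective_subtype _) res.surjective_rangeRestrict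
        (by rw [LinearMap.exact_iff, LinearMap.ker_rangeRestrict, range_subtype])
    have h2 : Module.length k (LinearMap.ker res) ≤ Module.length k ((V ⧸ N) →ₗ[k] E) := by
      refine Module.length_le_of_surjective ((LinearMap.lcomp k E N.mkQ).codRestrict _ ?_) ?_
      · intro ψ
        rw [LinearMap.mem_ker]
        ext x
        simp [hres, (Submodule.Quotient.mk_eq_zero N).2 x.2]
      · rintro ⟨ψ, hψ⟩
        refine ⟨N.liftQ ψ fun x hx => LinearMap.congr_fun hψ ⟨x, hx⟩, Subtype.ext ?_⟩
        ext x
        rfl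
    have h3 : Module.length k V = Module.length k N + Module.length k (V ⧸ N) :=
      Module.length_eq_add_of_exact N.subtype N.mkQ (Submodule.injective_subtype _)
        N.mkQ_surjective (LinearMap.exact_subtype_mkQ N)
    rw [h1, h3, add_comm, Module.length_eq_one k (V ⧸ N)]
    refine add_le_add ?_ (h2.trans (hE.length_dual_simple_le _))
    exact (Module.length_le_of_injective (LinearMap.range res).subtype
      (Submodule.injective_subtype _)).trans ih

lemma IsDualizing.isFiniteLength_dual {V : Type w} [AddCommGroup V] [Module k V]
    (hV : IsFiniteLength k V) : IsFiniteLength k (V →ₗ[k] E) := by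
  rw [← Module.length_ne_top_iff] at hV ⊢
  exact ne_top_of_le_ne_top hV (hE.length_dual_le (Module.length_ne_top_iff.1 hV))

lemma IsDualizing.eq_of_forall_dual {V : Type*} [AddCommGroup V] [Module k V] {x y : V}
    (h : ∀ φ : V →ₗ[k] E, φ x = φ y) : x = y := by
  by_contra hne
  obtain ⟨ψ, -, hψ⟩ := hE.exists_separating (⊥ : Submodule k V) (x - y)
    (by rwa [Submodule.mem_bot, sub_eq_zero])
  exact hψ (by rw [map_sub, h, sub_self])

/-- Finite length modules are reflexive. -/
lemma IsDualizing.exists_eval {V : Type w} [AddCommGroup V] [Module k V]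
    (hV : IsFiniteLength k V) (F : (V →ₗ[k] E) →ₗ[k] E) : ∃ x : V, ∀ φ, F φ = φ x := by
  set ev : V →ₗ[k] ((V →ₗ[k] E) →ₗ[k] E) := LinearMap.applyₗ with hev
  have hinj : Function.Injective ev := fun x y hxy =>
    hE.eq_of_forall_dual fun φ => LinearMap.congr_fun hxy φ
  have hfin := hE.isFiniteLength_dual (hE.isFiniteLength_dual hV)
  have hle := (hE.length_dual_le (hE.isFiniteLength_dual hV)).trans (hE.length_dual_le hV)
  obtain ⟨_, _⟩ := isFiniteLength_iff_isNoetherian_isArtinian.1 hfin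
  have htop : LinearMap.range ev = ⊤ := by
    by_contra h
    have h1 := Submodule.length_lt h
    rw [← (LinearEquiv.ofInjective ev hinj).length_eq] at h1
    exact absurd hle (not_le.2 h1)
  obtain ⟨x, hx⟩ := LinearMap.range_eq_top.1 htop F
  exact ⟨x, fun φ => by rw [← hx]; rfl⟩

end Duality

section Fitting

variable {Λ : Type u} [Ring Λ] {M : Type v} [AddCommGroup M] [Module Λ M]

lemma IndecMod.nontrivial (hM : IndecMod Λ M) : Nontrivial M :=
  (Submodule.nontrivial_iff Λ).1 ⟨⊤, ⊥, hM.1⟩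

/-- Fitting's lemma. -/
lemma IndecMod.bijective_or_isNilpotent [IsNoetherian Λ M] [IsArtinian Λ M] (hM : IndecMod Λ M)
    (f : Module.End Λ M) : Function.Bijective f ∨ IsNilpotent f := by
  obtain ⟨n, hn⟩ := Filter.eventually_atTop.1 (LinearMap.eventually_isCompl_ker_pow_range_pow f)
  have hc := hn (n + 1) n.le_succ
  rcases hM.2 _ _ le_top le_top hc.sup_eq_top hc.inf_eq_bot with h | h
  · left
    have hinj := LinearMap.ker_eq_bot.1 h
    rw [pow_succ, Module.End.mul_eq_comp, LinearMap.coe_comp] at hinj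
    exact IsArtinian.bijective_of_injective_endomorphism f hinj.of_comp
  · exact Or.inr ⟨n + 1, LinearMap.range_eq_bot.1 h⟩

lemma IndecMod.not_bijective_add [IsNoetherian Λ M] [IsArtinian Λ M] (hM : IndecMod Λ M)
    {f g : Module.End Λ M} (hf : ¬ Function.Bijective f) (hg : ¬ Function.Bijective g) :
    ¬ Function.Bijective (f + g) := by
  rw [← Module.End.isUnit_iff] at hf hg ⊢
  intro h
  obtain ⟨s, hs⟩ := h
  have hsum : (↑s⁻¹ : Module.End Λ M) * f + ↑s⁻¹ * g = 1 := by
    rw [← mul_add, ← hs, Units.inv_mul]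
  have hf' : ¬ IsUnit ((↑s⁻¹ : Module.End Λ M) * f) := by rwa [Units.isUnit_units_mul]
  have hg' : ¬ IsUnit ((↑s⁻¹ : Module.End Λ M) * g) := by rwa [Units.isUnit_units_mul]
  rw [Module.End.isUnit_iff] at hf'
  have hnil := (hM.bijective_or_isNilpotent _).resolve_left hf'
  rw [← eq_sub_iff_add_eq'] at hsum
  exact hg' (hsum ▸ hnil.isUnit_one_sub)

end Fitting

section AlmostSplit

variable {k : Type u} [CommRing k] {E : Type u} [AddCommGroup E] [Module k E]
  (hE : IsDualizing (k := k) E) {Λ : Type u} [Ring Λ] [Algebra k Λ]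
  {X : Type v} [AddCommGroup X] [Module Λ X] [Module k X] [IsScalarTower k Λ X] {n m : ℕ}
  {φ : Fin n → X →ₗ[k] E}

include hE in
lemma eq_of_forall_generator (hφ : span k (Set.range φ) = ⊤) {x y : X}
    (h : ∀ i, φ i x = φ i y) : x = y := by
  refine hE.eq_of_forall_dual fun ψ => ?_
  have hψ : ψ ∈ span k (Set.range φ) := hφ ▸ trivial
  induction hψ using Submodule.span_induction with
  | mem ψ hψ => obtain ⟨i, rfl⟩ := hψ; exact h i
  | zero => rfl
  | add ψ χ _ _ h1 h2 => rw [LinearMap.add_apply, h1, h2, LinearMap.add_apply]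
  | smul c ψ _ h1 => rw [LinearMap.smul_apply, h1, LinearMap.smul_apply]

include hE in
/-- A system of linear equations over `Λ` in an arbitrary module `N` is solvable provided it is
solvable up to the pairings with all the homomorphisms from `N` to a fixed module `X`. -/
lemma IsDualizing.exists_solution (hX : IsFiniteLength k X) (hφ : span k (Set.range φ) = ⊤)
    {a : Fin m → Fin n → Λ}
    (ha : ∀ b : Fin n → Λ, (∀ x, ∑ i, φ i (b i • x) = 0) → b ∈ span k (Set.range a))
    {N : Type w} [AddCommGroup N] [Module Λ N] [Module k N] [IsScalarTower k Λ N] (ν : Fin n → N)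
    (h : ∀ t : N →ₗ[Λ] X, ∑ i, φ i (t (ν i)) = 0) :
    ∃ y : Fin m → N, ∀ i, ν i = ∑ j, a j i • y j := by
  have : SMulCommClass Λ k N := IsScalarTower.to_smulCommClass'
  have : SMulCommClass Λ k X := IsScalarTower.to_smulCommClass'
  let A : (Fin m → N) →ₗ[k] (Fin n → N) :=
    { toFun := fun y i => ∑ j, a j i • y j
      map_add' := fun y z => by
        ext i
        simp only [Pi.add_apply, smul_add, Finset.sum_add_distrib]
      map_smul' := fun c y => by
        ext i
        simp only [Pi.smul_apply, RingHom.id_apply, Finset.smul_sum, smul_comm c] }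
  have hA : ∀ y i, A y i = ∑ j, a j i • y j := fun _ _ => rfl
  by_contra hcon
  have hν : ν ∉ LinearMap.range A := by
    rintro ⟨y, hy⟩
    exact hcon ⟨y, fun i => by rw [← hy, hA]⟩
  obtain ⟨ψ, hψ, hψν⟩ := hE.exists_separating _ _ hν
  have hψsum : ∀ w : Fin n → N, ψ w = ∑ i, ψ (Pi.single i (w i)) := fun w => by
    rw [← map_sum, Finset.univ_sum_single]
  let P : (Fin n → Λ) →ₗ[k] (X →ₗ[k] E) :=
    { toFun := fun b => ∑ i, φ i ∘ₗ Algebra.lsmul k k X (b i)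
      map_add' := fun b c => by
        simp only [Pi.add_apply, map_add, LinearMap.comp_add, Finset.sum_add_distrib]
      map_smul' := fun r b => by
        simp only [Pi.smul_apply, map_smul, LinearMap.comp_smul, Finset.smul_sum,
          RingHom.id_apply] }
  have hP : ∀ b x, P b x = ∑ i, φ i (b i • x) := fun b x => by
    simp [P, LinearMap.sum_apply]
  let Q : N → (Fin n → Λ) →ₗ[k] E := fun y =>
    { toFun := fun b => ψ fun i => b i • y
      map_add' := fun b c => by
        rw [← map_add]
        congr 1
        ext i
        exact add_smul _ _ _
      map_smul' := fun r b => by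
        rw [RingHom.id_apply, ← map_smul]
        congr 1
        ext i
        exact smul_assoc _ _ _ }
  have hQ : ∀ y b, Q y b = ψ fun i => b i • y := fun _ _ => rfl
  have hker : ∀ y, LinearMap.ker P ≤ LinearMap.ker (Q y) := by
    intro y b hb
    have hb' : b ∈ span k (Set.range a) := ha b fun x => by
      rw [← hP, LinearMap.mem_ker.1 hb, LinearMap.zero_apply]
    refine (span_le (p := LinearMap.ker (Q y))).2 ?_ hb'
    rintro _ ⟨j, rfl⟩
    rw [SetLike.mem_coe, LinearMap.mem_ker, hQ]
    refine hψ _ ⟨Pi.single j y, ?_⟩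
    ext i
    rw [hA, Finset.sum_eq_single j, Pi.single_eq_same]
    · intro l _ hl
      rw [Pi.single_eq_of_ne hl, smul_zero]
    · simp
  have hPsingle : ∀ i, P (Pi.single i 1) = φ i := by
    intro i
    ext x
    rw [hP, Finset.sum_eq_single i, Pi.single_eq_same, one_smul]
    · intro l _ hl
      rw [Pi.single_eq_of_ne hl, zero_smul, map_zero]
    · simp
  have hPsurj : LinearMap.range P = ⊤ := by
    rw [eq_top_iff, ← hφ, span_le]
    rintro _ ⟨i, rfl⟩
    exact ⟨_, hPsingle i⟩
  have hex : ∀ y, ∃ x : X, ∀ b, P b x = Q y b := by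
    intro y
    obtain ⟨x, hx⟩ := hE.exists_eval hX ((LinearMap.ker P).liftQ (Q y) (hker y) ∘ₗ
      (P.quotKerEquivOfSurjective (LinearMap.range_eq_top.1 hPsurj)).symm.toLinearMap)
    refine ⟨x, fun b => ?_⟩
    rw [← hx, LinearMap.comp_apply, LinearEquiv.coe_coe,
      ← LinearMap.quotKerEquivOfSurjective_apply_mk P (LinearMap.range_eq_top.1 hPsurj),
      LinearEquiv.symm_apply_apply, liftQ_apply]
  choose t ht using hex
  have huniq : ∀ x x', (∀ b, P b x = P b x') → x = x' := fun x x' hxx =>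
    eq_of_forall_generator hE hφ fun i => by rw [← hPsingle, hxx]
  let t' : N →ₗ[Λ] X :=
    { toFun := t
      map_add' := fun y z => huniq _ _ fun b => by
        rw [map_add, ht, ht, ht, hQ, hQ, hQ, ← map_add]
        congr 1
        ext i
        exact smul_add _ _ _
      map_smul' := fun r y => huniq _ _ fun b => by
        have h1 : P b (r • t y) = P (fun i => b i * r) (t y) := by
          simp only [hP, mul_smul]
        rw [RingHom.id_apply, h1, ht, ht, hQ, hQ]
        simp only [mul_smul] }
  apply hψν
  rw [hψsum, ← h t']
  refine Finset.sum_congr rfl fun i _ => ?_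
  have h1 := ht (ν i) (Pi.single i 1)
  rw [hPsingle] at h1
  change _ = φ i (t (ν i))
  rw [h1, hQ]
  congr 1
  ext l
  by_cases hl : l = i
  · subst hl
    rw [Pi.single_eq_same, Pi.single_eq_same, one_smul]
  · rw [Pi.single_eq_of_ne hl, Pi.single_eq_of_ne hl, zero_smul]

include hE in
/-- A vector detecting the isomorphisms among the endomorphisms of an indecomposable module. -/
lemma IsDualizing.exists_detecting [IsNoetherian Λ X] [IsArtinian Λ X] (hX : IsFiniteLength k X)
    (hind : IndecMod Λ X) (hφ : span k (Set.range φ) = ⊤) :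
    ∃ ν : Fin n → X, (∀ t : X →ₗ[Λ] X, ¬ Function.Bijective t → ∑ i, φ i (t (ν i)) = 0) ∧
      ∑ i, φ i (ν i) ≠ 0 := by
  have : SMulCommClass Λ k X := IsScalarTower.to_smulCommClass'
  have := hind.nontrivial
  let J : Submodule k (X →ₗ[Λ] X) :=
    { carrier := {t | ¬ Function.Bijective t}
      add_mem' := fun hs ht => hind.not_bijective_add hs ht
      zero_mem' := fun h => by
        obtain ⟨x, hx⟩ := exists_ne (0 : X)
        exact hx (h.1 rfl)
      smul_mem' := fun c t ht hct => ht <|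
        IsArtinian.bijective_of_injective_endomorphism t fun x y hxy => hct.1 <| by
          rw [LinearMap.smul_apply, hxy, LinearMap.smul_apply] }
  obtain ⟨ξ, hξ, hξ1⟩ := hE.exists_separating J LinearMap.id fun h => h Function.bijective_id
  let Θ : (X →ₗ[Λ] X) →ₗ[k] ((Fin n → X) →ₗ[k] E) :=
    { toFun := fun t => ∑ i, φ i ∘ₗ t.restrictScalars k ∘ₗ LinearMap.proj i
      map_add' := fun s t => by
        ext ν
        simp [LinearMap.sum_apply, Finset.sum_add_distrib]
      map_smul' := fun r t => by
        ext ν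
        simp [Finset.smul_sum] }
  have hΘ : ∀ t ν, Θ t ν = ∑ i, φ i (t (ν i)) := fun t ν => by
    simp [Θ, LinearMap.sum_apply]
  have hinj : Function.Injective Θ := by
    intro s t hst
    ext x
    refine eq_of_forall_generator hE hφ fun i => ?_
    have h1 := LinearMap.congr_fun hst (Pi.single i x)
    have h2 : ∀ s : X →ₗ[Λ] X, ∑ l, φ l (s ((Pi.single i x : Fin n → X) l)) = φ i (s x) := by
      intro s
      rw [Finset.sum_eq_single i, Pi.single_eq_same]
      · intro l _ hl
        rw [Pi.single_eq_of_ne hl, map_zero, map_zero]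
      · simp
    rwa [hΘ, hΘ, h2, h2] at h1
  obtain ⟨F, hF⟩ := hE.baer.extension_property Θ hinj ξ
  have hfin : IsFiniteLength k (Fin n → X) := by
    obtain ⟨_, _⟩ := isFiniteLength_iff_isNoetherian_isArtinian.1 hX
    exact isFiniteLength_iff_isNoetherian_isArtinian.2 ⟨inferInstance, inferInstance⟩
  obtain ⟨ν, hν⟩ := hE.exists_eval hfin F
  have hkey : ∀ t, ∑ i, φ i (t (ν i)) = ξ t := fun t => by
    rw [← hΘ, ← hν, ← hF]
    rfl
  refine ⟨ν, fun t ht => ?_, ?_⟩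
  · rw [hkey]
    exact hξ t ht
  · rw [← hkey] at hξ1
    exact hξ1

end AlmostSplit

section LeftAlmostSplit

/-- A homomorphism is left almost split if it is not a split monomorphism and every homomorphism
to a finite length module which is not a split monomorphism factors through it. -/
def IsLeftAlmostSplit {Λ : Type u} [Ring Λ] {X : Type v} [AddCommGroup X] [Module Λ X]
    {E : Type w} [AddCommGroup E] [Module Λ E] (f : X →ₗ[Λ] E) : Prop :=
  (¬ ∃ r : E →ₗ[Λ] X, r ∘ₗ f = LinearMap.id) ∧
    ∀ (N : Type v) [AddCommGroup N] [Module Λ N], IsFiniteLength Λ N → ∀ h : X →ₗ[Λ] N,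
      (¬ ∃ r : N →ₗ[Λ] X, r ∘ₗ h = LinearMap.id) → ∃ p : E →ₗ[Λ] N, h = p ∘ₗ f

lemma exists_isLeftAlmostSplit (k : Type u) [CommRing k] [IsArtinianRing k] {Λ : Type u} [Ring Λ]
    [Algebra k Λ] [Module.Finite k Λ] {X : Type v} [AddCommGroup X] [Module Λ X]
    (hX : IsFiniteLength Λ X) (hind : IndecMod Λ X) :
    ∃ (E : Type (max u v)) (_ : AddCommGroup E) (_ : Module Λ E) (f : X →ₗ[Λ] E),
      IsFiniteLength Λ E ∧ IsLeftAlmostSplit f := by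
  obtain ⟨I, _, _, hI⟩ := exists_isDualizing k
  obtain ⟨_, _⟩ := isFiniteLength_iff_isNoetherian_isArtinian.1 hX
  let _ : Module k X := Module.compHom X (algebraMap k Λ)
  have : IsScalarTower k Λ X := .of_algebraMap_smul fun _ _ => rfl
  have : Module.Finite k X := Module.Finite.trans Λ X
  have hXk : IsFiniteLength k X :=
    isFiniteLength_iff_isNoetherian_isArtinian.2 ⟨inferInstance, inferInstance⟩
  obtain ⟨_, _⟩ := isFiniteLength_iff_isNoetherian_isArtinian.1 (hI.isFiniteLength_dual hXk)
  obtain ⟨n, φ, hφ⟩ := Module.Finite.exists_fin (R := k) (M := X →ₗ[k] I)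
  let R : Submodule k (Fin n → Λ) :=
    { carrier := {b | ∀ x, ∑ i, φ i (b i • x) = 0}
      add_mem' := fun hb hc x => by
        simp only [Pi.add_apply, add_smul, map_add, Finset.sum_add_distrib, hb x, hc x, add_zero]
      zero_mem' := fun x => by simp
      smul_mem' := fun r b hb x => by
        simp only [Pi.smul_apply, smul_assoc, map_smul, ← Finset.smul_sum, hb x, smul_zero] }
  obtain ⟨m, a', ha'⟩ := Module.Finite.exists_fin (R := k) (M := R)
  let a : Fin m → Fin n → Λ := fun j => a' j
  have haR : ∀ j x, ∑ i, φ i (a j i • x) = 0 := fun j => (a' j).2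
  have ha : ∀ b : Fin n → Λ, (∀ x, ∑ i, φ i (b i • x) = 0) → b ∈ span k (Set.range a) := by
    intro b hb
    have h1 : (⟨b, hb⟩ : R) ∈ span k (Set.range a') := ha' ▸ trivial
    have h2 := Submodule.mem_map_of_mem (f := R.subtype) h1
    rwa [Submodule.map_span, ← Set.range_comp] at h2
  obtain ⟨ν, hν, hν1⟩ := hI.exists_detecting hXk hind hφ
  let A : Fin n → Fin m → Λ := fun i j => - a j i
  let K : Submodule Λ (X × (Fin m → Λ)) := span Λ (Set.range fun i => (ν i, A i))
  have : IsArtinianRing Λ := IsArtinianRing.of_finite k Λ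
  refine ⟨(X × (Fin m → Λ)) ⧸ K, inferInstance, inferInstance,
    K.mkQ ∘ₗ LinearMap.inl Λ X (Fin m → Λ),
    isFiniteLength_iff_isNoetherian_isArtinian.2 ⟨inferInstance, inferInstance⟩, ?_, ?_⟩
  · rintro ⟨r, hr⟩
    have hrx : ∀ x, r (K.mkQ (x, 0)) = x := fun x => LinearMap.congr_fun hr x
    have hsol : ∀ i, ν i = ∑ j, a j i • r (K.mkQ (0, Pi.single j 1)) := by
      intro i
      have h1 : K.mkQ (ν i, A i) = 0 :=
        (Submodule.Quotient.mk_eq_zero K).2 (subset_span ⟨i, rfl⟩)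
      have h2 : (ν i, A i) = ((ν i, 0) : X × (Fin m → Λ)) -
          ∑ j, a j i • ((0, Pi.single j 1) : X × (Fin m → Λ)) := by
        refine Prod.ext ?_ ?_
        · simp [Prod.fst_sum]
        · ext j
          simp [Prod.snd_sum, A, Finset.sum_apply, Pi.single_apply]
      rw [h2, map_sub, sub_eq_zero] at h1
      have h3 := congrArg r h1
      rw [hrx, map_sum, map_sum] at h3
      rw [h3]
      exact Finset.sum_congr rfl fun j _ => by rw [map_smul, map_smul]
    apply hν1
    simp_rw [hsol, map_sum]
    rw [Finset.sum_comm]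
    exact Finset.sum_eq_zero fun j _ => haR j _
  · intro N _ _ _ h hh
    let _ : Module k N := Module.compHom N (algebraMap k Λ)
    have : IsScalarTower k Λ N := .of_algebraMap_smul fun _ _ => rfl
    obtain ⟨y, hy⟩ := hI.exists_solution hXk hφ ha (fun i => h (ν i)) fun t =>
      hν (t ∘ₗ h) fun hbij => hh ⟨(LinearEquiv.ofBijective _ hbij).symm.toLinearMap ∘ₗ t, by
        ext x
        exact (LinearEquiv.ofBijective _ hbij).symm_apply_apply x⟩
    refine ⟨K.liftQ (h.coprod (Fintype.linearCombination Λ y)) ?_, ?_⟩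
    · rw [span_le]
      rintro _ ⟨i, rfl⟩
      rw [SetLike.mem_coe, LinearMap.mem_ker, LinearMap.coprod_apply,
        Fintype.linearCombination_apply, hy i]
      simp [A]
    · ext x
      simp

/-- Existence of minimal left almost split homomorphisms. -/
lemma exists_isLeftAlmostSplit_minimal (k : Type u) [CommRing k] [IsArtinianRing k] {Λ : Type u}
    [Ring Λ] [Algebra k Λ] [Module.Finite k Λ] {X : Type v} [AddCommGroup X] [Module Λ X]
    (hX : IsFiniteLength Λ X) (hind : IndecMod Λ X) :
    ∃ (E : Type (max u v)) (_ : AddCommGroup E) (_ : Module Λ E) (f : X →ₗ[Λ] E),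
      IsFiniteLength Λ E ∧ IsLeftAlmostSplit f ∧
        ∀ a : E →ₗ[Λ] E, a ∘ₗ f = f → Function.Bijective a := by
  classical
  have hex : ∃ l : ℕ, ∃ (E : Type (max u v)) (_ : AddCommGroup E) (_ : Module Λ E)
      (f : X →ₗ[Λ] E), Module.length Λ E = l ∧ IsLeftAlmostSplit f := by
    obtain ⟨E, _, _, f, hE, hf⟩ := exists_isLeftAlmostSplit k hX hind
    exact ⟨_, E, _, _, f, (ENat.natCast_toNat (Module.length_ne_top_iff.2 hE)).symm, hf⟩
  obtain ⟨E, _, _, f, hl, hf⟩ := Nat.find_spec hex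
  have hE : IsFiniteLength Λ E := Module.length_ne_top_iff.1 (hl ▸ ENat.natCast_ne_top _)
  obtain ⟨_, _⟩ := isFiniteLength_iff_isNoetherian_isArtinian.1 hE
  refine ⟨E, inferInstance, inferInstance, f, hE, hf, fun a ha => ?_⟩
  refine IsArtinian.bijective_of_injective_endomorphism a ?_
  obtain ⟨n, hn⟩ := Filter.eventually_atTop.1 (LinearMap.eventually_isCompl_ker_pow_range_pow a)
  have hc := hn (n + 1) n.le_succ
  set b := a ^ (n + 1) with hb
  have hbf : ∀ x, b (f x) = f x := by
    have hpow : ∀ m x, (a ^ m) (f x) = f x := by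
      intro m x
      induction m with
      | zero => rfl
      | succ m ih => rw [pow_succ, Module.End.mul_apply, ← LinearMap.comp_apply a f, ha, ih]
    exact hpow _
  let f' : X →ₗ[Λ] LinearMap.range b := f.codRestrict _ fun x => ⟨f x, hbf x⟩
  let π : E →ₗ[Λ] LinearMap.range b := (LinearMap.range b).projectionOnto _ hc.symm
  have hf' : IsLeftAlmostSplit f' := by
    refine ⟨fun ⟨r, hr⟩ => hf.1 ⟨r ∘ₗ π, ?_⟩, fun N _ _ hN h hh => ?_⟩
    · ext x
      have h1 : π (f x) = f' x := Submodule.projectionOnto_apply_left hc.symm (f' x)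
      rw [LinearMap.comp_apply, LinearMap.comp_apply, h1, ← LinearMap.comp_apply, hr]
    · obtain ⟨p, rfl⟩ := hf.2 N hN h hh
      exact ⟨p ∘ₗ (LinearMap.range b).subtype, rfl⟩
  have htop : LinearMap.range b = ⊤ := by
    by_contra hne
    have h1 := Submodule.length_lt hne
    have h2 : Module.length Λ (LinearMap.range b) ≠ ⊤ := h1.ne_top
    have h3 := Nat.find_min' hex ⟨_, _, _, f', (ENat.natCast_toNat h2).symm, hf'⟩
    rw [← ENat.natCast_le_natCast, ENat.natCast_toNat h2, ← hl] at h3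
    exact absurd h3 (not_le.2 h1)
  have hker := hc.disjoint.eq_bot
  rw [htop, inf_top_eq] at hker
  have hinj := LinearMap.ker_eq_bot.1 hker
  rw [hb, pow_succ, Module.End.mul_eq_comp, LinearMap.coe_comp] at hinj
  exact hinj.of_comp

end LeftAlmostSplit

section Component

variable {Λ : Type u} [Ring Λ]

section

variable {Y : Type v} [AddCommGroup Y] [Module Λ Y] {X : Submodule Λ Y}

lemma IsGRSub.not_retract (hX : IsGRSub Λ X) :
    ¬ ∃ r : Y →ₗ[Λ] X, r ∘ₗ X.subtype = LinearMap.id := by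
  rintro ⟨r, hr⟩
  exact IndecSub.not_retract hX.1 hX.2.2.1.lt_top hX.2.1.1 (r ∘ₗ (⊤ : Submodule Λ Y).subtype)
    fun w => LinearMap.congr_fun hr w

variable [IsNoetherian Λ Y] [IsArtinian Λ Y]

lemma IsGRSub.mu_le (hX : IsGRSub Λ X) {Z : Submodule Λ Y} (hZ : Z ≠ ⊤) : mu Λ Z ≤ mu Λ X := by
  have h1 := mu_add_le hX.1 hZ.lt_top
  rw [hX.2.2.2] at h1
  exact le_of_add_le_add_right h1

lemma IsGRSub.isGRInclusion (hX : IsGRSub Λ X) {φ : X →ₗ[Λ] Y} (hφ : Function.Injective φ) :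
    IsGRInclusion Λ φ := by
  have hmu : mu Λ (LinearMap.range φ) = mu Λ X := by rw [mu_range hφ, mu_coe]
  refine ⟨hφ, hX.1, (indecSub_range hφ).2 ((indecMod_coe X).2 hX.2.1), fun htop => ?_, ?_⟩
  · have h1 := mu_lt hX.1 hX.2.2.1.lt_top
    rw [← hmu, htop] at h1
    exact lt_irrefl _ h1
  · rw [hmu, hX.2.2.2]

/-- If a Gabriel-Roiter inclusion factors through a homomorphism which is not a split
monomorphism, then it can be replaced by one factoring through an indecomposable direct summand
of the intermediate module that is mapped onto `Y`. -/
lemma IsGRSub.exists_component (hX : IsGRSub Λ X) {E : Type w} [AddCommGroup E] [Module Λ E]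
    [IsArtinian Λ E] (f : X →ₗ[Λ] E) (hf : ¬ ∃ r : E →ₗ[Λ] X, r ∘ₗ f = LinearMap.id)
    (g : E →ₗ[Λ] Y) (hgf : X.subtype = g ∘ₗ f) :
    ∃ e : Module.End Λ E, e * e = e ∧ IndecSub Λ (LinearMap.range e) ∧
      Function.Surjective (g ∘ₗ e) ∧ Function.Injective ((g ∘ₗ e) ∘ₗ f) := by
  obtain ⟨l, hl, hle⟩ := exists_list_idempotent (⊤ : Submodule Λ E) 1 (one_mul 1)
    (LinearMap.range_eq_top.2 Function.surjective_id)
  by_contra! hcon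
  choose P hP0 hP using fun N : Submodule Λ Y => exists_jointly_injective N
  obtain ⟨q, ⟨e, he, hq⟩, hqX⟩ := exists_injective_or_mu_lt X hX.2.1
    {q | ∃ e ∈ l, (LinearMap.range (g ∘ₗ e) ≠ ⊤ ∧ ∃ p ∈ P (LinearMap.range (g ∘ₗ e)),
        q = (p ∘ₗ (g ∘ₗ e).rangeRestrict) ∘ₗ f) ∨
      (LinearMap.range (g ∘ₗ e) = ⊤ ∧ q = (g ∘ₗ e) ∘ₗ f)} fun x hx => by
        have hzero : ∀ e ∈ l, g (e (f x)) = 0 := by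
          intro e he
          by_cases htop : LinearMap.range (g ∘ₗ e) = ⊤
          · exact hx _ ⟨e, he, Or.inr ⟨htop, rfl⟩⟩
          · exact congrArg Subtype.val (hP0 _ ((g ∘ₗ e).rangeRestrict (f x)) fun p hp =>
              hx _ ⟨e, he, Or.inl ⟨htop, p, hp, rfl⟩⟩)
        have hsum : g ((l.sum : Module.End Λ E) (f x)) = 0 := by
          clear hl hle hcon hx
          induction l with
          | nil => exact map_zero g
          | cons a l ih =>
            simp only [List.mem_cons, forall_eq_or_imp] at hzero
            rw [List.sum_cons, LinearMap.add_apply, map_add, hzero.1, ih hzero.2, add_zero]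
        rw [hl] at hsum
        exact Subtype.ext ((LinearMap.congr_fun hgf x).trans hsum)
  rcases hq with ⟨hne, p, hp, rfl⟩ | ⟨htop, rfl⟩
  · obtain ⟨hpZ, hpi⟩ := hP _ p hp
    have hle : LinearMap.range ((p ∘ₗ (g ∘ₗ e).rangeRestrict) ∘ₗ f) ≤ LinearMap.range p := by
      rintro _ ⟨x, rfl⟩
      exact ⟨_, rfl⟩
    have hpX : mu Λ (LinearMap.range p) ≤ mu Λ X := (mu_mono hpZ).trans (hX.mu_le hne)
    rcases hqX with hq | hq
    · rcases hle.eq_or_lt with heq | hlt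
      · have hr : ∀ x, (p ∘ₗ (g ∘ₗ e).rangeRestrict) x ∈
            LinearMap.range ((p ∘ₗ (g ∘ₗ e).rangeRestrict) ∘ₗ f) := fun x => heq ▸ ⟨_, rfl⟩
        exact hf ⟨(LinearEquiv.ofInjective _ hq).symm.toLinearMap ∘ₗ
          (p ∘ₗ (g ∘ₗ e).rangeRestrict).codRestrict _ hr,
          LinearMap.ext fun x => (LinearEquiv.ofInjective _ hq).symm_apply_eq.2 rfl⟩
      · refine absurd hpX (not_le.2 ?_)
        rw [← mu_coe X, ← mu_range hq]
        exact mu_lt hpi hlt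
    · exact absurd (hq.trans_le (mu_mono hle)) (not_lt.2 hpX)
  · rcases hqX with hq | hq
    · exact hcon e (hle e he).1 (hle e he).2 (LinearMap.range_eq_top.1 htop) hq
    · refine absurd (hX.mu_le fun h => ?_) (not_le.2 hq)
      have h1 := subLen_range_le ((g ∘ₗ e) ∘ₗ f)
      rw [h] at h1
      exact absurd (subLen_lt hX.2.2.1.lt_top) (not_lt.2 h1)

end

/-- The components of a minimal left almost split homomorphism are irreducible. -/
lemma IsLeftAlmostSplit.isIrreducibleHom {X : Type v} [AddCommGroup X] [Module Λ X] {E : Type w}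
    [AddCommGroup E] [Module Λ E] {f : X →ₗ[Λ] E} (hf : IsLeftAlmostSplit f)
    (hmin : ∀ a : E →ₗ[Λ] E, a ∘ₗ f = f → Function.Bijective a) {M : Type v} [AddCommGroup M]
    [Module Λ M] (ι : M →ₗ[Λ] E) (π : E →ₗ[Λ] M) (hπι : ∀ x, π (ι x) = x)
    (hinj : Function.Injective (π ∘ₗ f)) : IsIrreducibleHom Λ (π ∘ₗ f) := by
  have hsplit : ¬ IsSplitMonoHom Λ (π ∘ₗ f) := fun ⟨r, hr⟩ => hf.1 ⟨r ∘ₗ π, hr⟩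
  refine ⟨hsplit, fun ⟨s, hs⟩ => hsplit ⟨s, ?_⟩, fun Z _ _ hZ h g' hgh => ?_⟩
  · ext x
    exact hinj (LinearMap.congr_fun hs ((π ∘ₗ f) x))
  · rw [or_iff_not_imp_left]
    intro hh
    obtain ⟨p, rfl⟩ := hf.2 Z hZ h hh
    let a : E →ₗ[Λ] E := ι ∘ₗ g' ∘ₗ p + (LinearMap.id - ι ∘ₗ π)
    have haf : a ∘ₗ f = f := by
      ext x
      have h1 : π (f x) = g' (p (f x)) := LinearMap.congr_fun hgh x
      simp [a, h1]
    have hπa : ∀ x, π (a x) = g' (p x) := fun x => by simp [a, hπι]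
    let b := LinearEquiv.ofBijective a (hmin a haf)
    refine ⟨p ∘ₗ b.symm.toLinearMap ∘ₗ ι, ?_⟩
    ext x
    have h2 : a (b.symm (ι x)) = ι x := b.apply_symm_apply (ι x)
    simp only [LinearMap.comp_apply, LinearEquiv.coe_coe, LinearMap.id_apply]
    rw [← hπa, h2, hπι]

end Component

section Small

variable {k : Type u} [CommRing k]

lemma IsFiniteLength.small_of_isNilpotent {m : Ideal k} (hm : m.IsMaximal) [Small.{v} (k ⧸ m)]
    {V : Type w} [AddCommGroup V] [Module k V] (hV : IsFiniteLength k V)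
    (h : ∀ r ∈ m, ∃ n : ℕ, ∀ x : V, r ^ n • x = 0) : Small.{v} V := by
  induction hV with
  | of_subsingleton => infer_instance
  | @of_simple_quotient V _ _ N hN _ ih =>
    have hNs : Small.{v} N := ih fun r hr => by
      obtain ⟨n, hn⟩ := h r hr
      exact ⟨n, fun x => Subtype.ext (hn x)⟩
    obtain ⟨m', hm', ⟨e⟩⟩ := isSimpleModule_iff_quot_maximal.1 hN
    have hle : m ≤ m' := by
      intro r hr
      obtain ⟨n, hn⟩ := h r hr
      obtain ⟨x, hx⟩ := N.mkQ_surjective (e.symm (m'.mkQ 1))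
      have h1 : m'.mkQ (r ^ n) = 0 := by
        rw [← mul_one (r ^ n), ← smul_eq_mul, map_smul, ← e.apply_symm_apply (m'.mkQ 1), ← hx,
          ← map_smul, ← map_smul, hn, map_zero, map_zero]
      exact hm'.isPrime.mem_of_pow_mem n ((Submodule.Quotient.mk_eq_zero m').1 h1)
    obtain rfl := hm.eq_of_le hm'.ne_top hle
    have : Small.{v} (V ⧸ N) := small_map e.toEquiv
    have hmem : ∀ x : V, x - Function.surjInv N.mkQ_surjective (N.mkQ x) ∈ N := fun x => by
      rw [← Submodule.Quotient.mk_eq_zero, ← mkQ_apply, map_sub,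
        Function.surjInv_eq N.mkQ_surjective, sub_self]
    refine small_of_injective (β := N × (V ⧸ N)) (f := fun x => (⟨_, hmem x⟩, N.mkQ x))
      fun x y hxy => ?_
    have h1 := congrArg (fun z => (z.1 : V)) hxy
    have h2 := congrArg Prod.snd hxy
    simp only at h1 h2
    rwa [h2, sub_left_inj] at h1

lemma IndecMod.small_of_surjective (k : Type u) [CommRing k] [IsArtinianRing k] {Λ : Type u}
    [Ring Λ] [Algebra k Λ] [Module.Finite k Λ] {M : Type w} [AddCommGroup M] [Module Λ M]
    (hM : IsFiniteLength Λ M) (hind : IndecMod Λ M) {Y : Type v} [AddCommGroup Y] [Module Λ Y]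
    [Nontrivial Y] {g : M →ₗ[Λ] Y} (hg : Function.Surjective g) : Small.{v} M := by
  obtain ⟨_, _⟩ := isFiniteLength_iff_isNoetherian_isArtinian.1 hM
  have : Module.Finite Λ Y := Module.Finite.of_surjective g hg
  let _ : Module k M := Module.compHom M (algebraMap k Λ)
  have : IsScalarTower k Λ M := .of_algebraMap_smul fun _ _ => rfl
  let _ : Module k Y := Module.compHom Y (algebraMap k Λ)
  have : IsScalarTower k Λ Y := .of_algebraMap_smul fun _ _ => rfl
  have : SMulCommClass Λ k M := IsScalarTower.to_smulCommClass'
  have : Module.Finite k M := Module.Finite.trans Λ M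
  have : Module.Finite k Y := Module.Finite.trans Λ Y
  obtain ⟨W, hW, -⟩ := (eq_top_or_exists_le_coatom (⊥ : Submodule k Y)).resolve_left bot_ne_top
  obtain ⟨m, hm, ⟨e⟩⟩ := isSimpleModule_iff_quot_maximal.1 (isSimpleModule_iff_isCoatom.2 hW)
  have : Small.{v} (k ⧸ m) := small_map e.symm.toEquiv
  refine IsFiniteLength.small_of_isNilpotent hm
    (isFiniteLength_iff_isNoetherian_isArtinian.2 ⟨inferInstance, inferInstance⟩) fun r hr => ?_
  rcases hind.bijective_or_isNilpotent (r • LinearMap.id) with hbij | ⟨n, hn⟩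
  · refine absurd (eq_top_iff.2 fun y _ => ?_) hW.1
    obtain ⟨x, rfl⟩ := hg y
    obtain ⟨x, rfl⟩ := hbij.2 x
    have h1 : g ((r • LinearMap.id : M →ₗ[Λ] M) x) = r • g x := by
      rw [LinearMap.smul_apply, LinearMap.id_apply]
      exact map_smul g (algebraMap k Λ r) x
    obtain ⟨t, ht⟩ := m.mkQ_surjective (e (W.mkQ (g x)))
    rw [h1, ← Submodule.Quotient.mk_eq_zero, ← mkQ_apply, map_smul]
    refine e.injective ?_
    rw [map_smul, ← ht, ← map_smul, map_zero, mkQ_apply, Submodule.Quotient.mk_eq_zero]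
    exact m.mul_mem_right t hr
  · refine ⟨n, fun x => ?_⟩
    have h1 := LinearMap.congr_fun hn x
    rwa [smul_pow, ← Module.End.one_eq_id, one_pow, LinearMap.smul_apply, Module.End.one_apply,
      LinearMap.zero_apply] at h1

end Small

/-- If `X ⊂ Y` is a Gabriel-Roiter inclusion, then there exist an
indecomposable finite length module `M`, an irreducible monomorphism `f : X → M` and an
epimorphism `g : M → Y` such that `g ∘ f : X → Y` is a monomorphism (and hence again a
Gabriel-Roiter inclusion). -/
theorem gabriel_roiter_stmt0
    (k : Type u) [CommRing k] [IsArtinianRing k]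
    (Λ : Type u) [Ring Λ] [Algebra k Λ] [Module.Finite k Λ]
    (Y : Type v) [AddCommGroup Y] [Module Λ Y] (hYfl : IsFiniteLength Λ Y)
    (X : Submodule Λ Y) (hX : IsGRSub Λ X) :
    ∃ M : ModuleCat.{v} Λ, IsFiniteLength Λ M ∧ IndecMod Λ M ∧
      ∃ (f : ↥X →ₗ[Λ] ↥M) (g : ↥M →ₗ[Λ] Y),
        IsIrreducibleHom Λ f ∧ Function.Injective f ∧ Function.Surjective g ∧
          Function.Injective (g.comp f) ∧ IsGRInclusion Λ (g.comp f) := by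
  obtain ⟨_, _⟩ := isFiniteLength_iff_isNoetherian_isArtinian.1 hYfl
  have := hX.1.nontrivial
  have hXfl : IsFiniteLength Λ X :=
    isFiniteLength_iff_isNoetherian_isArtinian.2 ⟨inferInstance, inferInstance⟩
  obtain ⟨E, _, _, f, hE, hf, hmin⟩ :=
    exists_isLeftAlmostSplit_minimal k hXfl ((indecMod_coe X).2 hX.2.1)
  obtain ⟨_, _⟩ := isFiniteLength_iff_isNoetherian_isArtinian.1 hE
  obtain ⟨g, hg⟩ := hf.2 Y hYfl X.subtype hX.not_retract
  obtain ⟨e, hee, hind, hsurj, hinj⟩ := hX.exists_component f hf.1 g hg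
  have heM : ∀ x : LinearMap.range e, e x = x := by
    rintro ⟨_, y, rfl⟩
    exact LinearMap.congr_fun hee y
  have hM : IsFiniteLength Λ (LinearMap.range e) :=
    isFiniteLength_iff_isNoetherian_isArtinian.2 ⟨inferInstance, inferInstance⟩
  have hMg : Function.Surjective (g ∘ₗ (LinearMap.range e).subtype) := fun y => by
    obtain ⟨x, rfl⟩ := hsurj y
    exact ⟨⟨e x, x, rfl⟩, rfl⟩
  have hsmall : Small.{v} (LinearMap.range e) :=
    ((indecMod_coe _).2 hind).small_of_surjective k hM hMg
  let s : Shrink.{v} (LinearMap.range e) ≃ₗ[Λ] LinearMap.range e := Shrink.linearEquiv Λ _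
  let ι := (LinearMap.range e).subtype ∘ₗ s.toLinearMap
  let π := s.symm.toLinearMap ∘ₗ e.rangeRestrict
  have hιπ : ∀ x, ι (π x) = e x := fun x => by simp [ι, π]
  have hcomp : (g ∘ₗ ι) ∘ₗ π ∘ₗ f = (g ∘ₗ e) ∘ₗ f := by
    ext x
    exact congrArg g (hιπ (f x))
  have hπι : ∀ x, π (ι x) = x := fun x =>
    s.symm_apply_eq.2 (Subtype.ext (heM (s x)))
  rw [← hcomp] at hinj
  have hπf : Function.Injective (π ∘ₗ f) := by
    rw [LinearMap.coe_comp] at hinj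
    exact hinj.of_comp
  refine ⟨ModuleCat.of Λ (Shrink.{v} (LinearMap.range e)), s.symm.isFiniteLength hM, ?_, π ∘ₗ f,
    g ∘ₗ ι, hf.isIrreducibleHom hmin ι π hπι hπf, hπf, hMg.comp s.surjective, hinj,
    hX.isGRInclusion hinj⟩
  rw [← indecSub_range (φ := ι) ((LinearMap.range e).injective_subtype.comp s.injective)]
  rwa [LinearMap.range_comp_of_range_eq_top _ s.range, range_subtype]
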